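/- Let ℓ ∈ (1,2] and let f be a Cherry map of exponent ℓ whose rotation number ρ(f) is of bounded type, with q_n the denominators of the convergents of ρ(f), and let c be the constant value of f on the closure of U. Then there exist constants K > 0 and C ∈ (0,1) such that for all sufficiently large n, (−log |f^{q_n}(c) − c|)/q_{n+1} ≤ K·Cⁿ. -/

import Mathlib

open Filter

noncomputable section

/-- The Gauss map `x ↦ {1/x}`. -/
def gaussMap (x : ℝ) : ℝ := Int.fract (1 / x)

/-- The `n`-th partial quotient (`n ≥ 1`) of the continued fraction expansion
`ρ = [0; a_1, a_2, …]` of an irrational `ρ ∈ (0,1)`. -/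
def cfA (ρ : ℝ) (n : ℕ) : ℕ := ⌊1 / (gaussMap^[n - 1] ρ)⌋₊

/-- The denominators of the convergents of `ρ`: `q_0 = 1`, `q_1 = a_1`,
`q_{n+2} = a_{n+2} q_{n+1} + q_n`. -/
def cfQ (ρ : ℝ) : ℕ → ℕ
  | 0 => 1
  | 1 => cfA ρ 1
  | n + 2 => cfA ρ (n + 2) * cfQ ρ (n + 1) + cfQ ρ n

/-- `ρ` is of bounded type if its partial quotients are bounded. -/
def BoundedType (ρ : ℝ) : Prop := ∃ M : ℕ, ∀ i ≥ 1, cfA ρ i ≤ M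

/-- A Cherry map of exponent `ℓ > 1`: a continuous degree-one monotone circle map with a
flat open arc `U = (a,b)`, a `C^∞` diffeomorphism off the closure of `U`, behaving like
`x ↦ x^ℓ` in one-sided `C^∞` local coordinates at the endpoints of `U`, and with no
periodic points (hence irrational rotation number `rho`). -/
structure CherryMap (ℓ : ℝ) where
  /-- the circle map -/
  f : AddCircle (1 : ℝ) → AddCircle (1 : ℝ)
  /-- a lift of `f` to the real line -/
  F : ℝ → ℝ
  cont : Continuous f
  isLift : ∀ x : ℝ, f (x : AddCircle (1 : ℝ)) = ((F x : ℝ) : AddCircle (1 : ℝ))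
  mono : Monotone F
  degree_one : ∀ x : ℝ, F (x + 1) = F x + 1
  /-- left endpoint of the flat arc -/
  a : ℝ
  /-- right endpoint of the flat arc -/
  b : ℝ
  hab : a < b
  hba : b < a + 1
  /-- `f` is constant on the closure of `U = (a,b)` -/
  flat : ∀ x ∈ Set.Icc a b, F x = F a
  /-- `f` is `C^∞` off the closure of `U` -/
  smooth : ContDiffOn ℝ (⊤ : ℕ∞) F (Set.Ioo b (a + 1))
  /-- `f` is a diffeomorphism onto its image off the closure of `U` -/
  deriv_pos : ∀ x ∈ Set.Ioo b (a + 1), 0 < deriv F x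
  /-- radius of the one-sided coordinate neighbourhoods at `a` and `b` -/
  ε : ℝ
  εpos : 0 < ε
  /-- `C^∞` local coordinate at `a` -/
  ψa : ℝ → ℝ
  /-- `C^∞` local coordinate at `b` -/
  ψb : ℝ → ℝ
  ψa_smooth : ContDiff ℝ (⊤ : ℕ∞) ψa
  ψb_smooth : ContDiff ℝ (⊤ : ℕ∞) ψb
  ψa_zero : ψa 0 = 0
  ψb_zero : ψb 0 = 0
  ψa_deriv_pos : 0 < deriv ψa 0
  ψb_deriv_pos : 0 < deriv ψb 0
  /-- near `b`, `f` is `x ↦ x^ℓ` in the local coordinate -/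
  local_b : ∀ t ∈ Set.Ico (0 : ℝ) ε, F (b + t) = F b + ψb (t ^ ℓ)
  /-- near `a`, `f` is `x ↦ x^ℓ` in the local coordinate -/
  local_a : ∀ t ∈ Set.Ico (0 : ℝ) ε, F (a - t) = F a - ψa (t ^ ℓ)
  /-- `f` has no periodic points -/
  no_periodic_pt : ∀ (x : AddCircle (1 : ℝ)) (n : ℕ), 1 ≤ n → f^[n] x ≠ x
  /-- the rotation number of `f` -/
  rho : ℝ
  rho_mem : rho ∈ Set.Ioo (0 : ℝ) 1
  rho_irrational : Irrational rho
  rho_lim : ∃ m : ℤ, ∀ x : ℝ,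
    Tendsto (fun n : ℕ => F^[n] x / n) atTop (nhds (rho + m))

namespace CherryMap

variable {ℓ : ℝ}

/-- The flat arc `U = (a,b)` of a Cherry map, as a subset of the circle. -/
def U (X : CherryMap ℓ) : Set (AddCircle (1 : ℝ)) :=
  (fun t : ℝ => (t : AddCircle (1 : ℝ))) '' Set.Ioo X.a X.b

/-- The constant value `c = f(a)` of a Cherry map on the closure of its flat arc. -/
def c (X : CherryMap ℓ) : AddCircle (1 : ℝ) := X.f ((X.a : ℝ) : AddCircle (1 : ℝ))

end CherryMap

end

theorem gaussMap_iterate_mem {ρ : ℝ} (hρ : ρ ∈ Set.Ioo (0 : ℝ) 1) (hirr : Irrational ρ) (n : ℕ) :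
    gaussMap^[n] ρ ∈ Set.Ioo (0 : ℝ) 1 ∧ Irrational (gaussMap^[n] ρ) := by
  induction n with
  | zero => exact ⟨hρ, hirr⟩
  | succ n ih =>
    rw [Function.iterate_succ_apply']
    obtain ⟨-, h2⟩ := ih
    set x := gaussMap^[n] ρ
    have h3 : Irrational (gaussMap x) := by
      unfold gaussMap Int.fract
      rw [one_div]
      exact h2.inv.sub_intCast _
    refine ⟨⟨lt_of_le_of_ne (Int.fract_nonneg _) (fun h => h3.ne_zero h.symm), Int.fract_lt_one _⟩, h3⟩

theorem gaussMap_iterate_succ {ρ : ℝ} (hρ : ρ ∈ Set.Ioo (0 : ℝ) 1) (hirr : Irrational ρ) (n : ℕ) :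
    gaussMap^[n + 1] ρ = 1 / gaussMap^[n] ρ - cfA ρ (n + 1) := by
  have h := (gaussMap_iterate_mem hρ hirr n).1
  rw [Function.iterate_succ_apply', gaussMap, cfA, Nat.add_sub_cancel, Int.fract,
    natCast_floor_eq_intCast_floor (one_div_pos.2 h.1).le]

theorem one_le_cfA {ρ : ℝ} (hρ : ρ ∈ Set.Ioo (0 : ℝ) 1) (hirr : Irrational ρ) (n : ℕ) :
    1 ≤ cfA ρ (n + 1) := by
  have h := (gaussMap_iterate_mem hρ hirr n).1
  rw [cfA, Nat.add_sub_cancel, Nat.one_le_floor_iff]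
  exact (one_le_div h.1).2 h.2.le

theorem cfQ_pos {ρ : ℝ} (hρ : ρ ∈ Set.Ioo (0 : ℝ) 1) (hirr : Irrational ρ) (n : ℕ) :
    0 < cfQ ρ n := by
  induction n using Nat.twoStepInduction with
  | zero => simp [cfQ]
  | one => exact one_le_cfA hρ hirr 0
  | more n h1 h2 => rw [cfQ]; positivity

theorem cfQ_le_succ {ρ : ℝ} (hρ : ρ ∈ Set.Ioo (0 : ℝ) 1) (hirr : Irrational ρ) (n : ℕ) :
    cfQ ρ n ≤ cfQ ρ (n + 1) := by
  cases n with
  | zero => exact one_le_cfA hρ hirr 0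
  | succ n =>
    rw [cfQ]
    nlinarith [one_le_cfA hρ hirr (n + 1), cfQ_pos hρ hirr (n + 1)]

/-- The numerators of the convergents of `ρ`. -/
noncomputable def cfP (ρ : ℝ) : ℕ → ℤ
  | 0 => 0
  | 1 => 1
  | n + 2 => cfA ρ (n + 2) * cfP ρ (n + 1) + cfP ρ n

theorem cfP_mul_cfQ_sub (ρ : ℝ) (n : ℕ) :
    cfP ρ (n + 1) * cfQ ρ n - cfP ρ n * cfQ ρ (n + 1) = (-1) ^ n := by
  induction n with
  | zero => simp [cfP, cfQ]
  | succ n ih => rw [cfP, cfQ, pow_succ, ← ih]; push_cast; ring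

theorem isCoprime_cfP_cfQ (ρ : ℝ) (n : ℕ) : IsCoprime (cfP ρ n) (cfQ ρ n : ℤ) := by
  refine ⟨-((-1) ^ n * cfQ ρ (n + 1)), (-1) ^ n * cfP ρ (n + 1), ?_⟩
  have h := cfP_mul_cfQ_sub ρ n
  have h2 : ((-1 : ℤ) ^ n) * (-1) ^ n = 1 := by rw [← mul_pow]; simp
  linear_combination (-1) ^ n * h + h2

/-- The product `g_0 g_1 ⋯ g_n` of the iterates of the Gauss map along the orbit of `ρ`. -/
noncomputable def gaussProd (ρ : ℝ) (n : ℕ) : ℝ := ∏ i ∈ Finset.range (n + 1), gaussMap^[i] ρ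

theorem gaussProd_pos {ρ : ℝ} (hρ : ρ ∈ Set.Ioo (0 : ℝ) 1) (hirr : Irrational ρ) (n : ℕ) :
    0 < gaussProd ρ n :=
  Finset.prod_pos fun i _ => (gaussMap_iterate_mem hρ hirr i).1.1

theorem gaussProd_one {ρ : ℝ} (hρ : ρ ∈ Set.Ioo (0 : ℝ) 1) (hirr : Irrational ρ) :
    gaussProd ρ 1 = 1 - cfA ρ 1 * ρ := by
  have h := gaussMap_iterate_succ hρ hirr 0
  have := hρ.1.ne'
  rw [gaussProd, Finset.prod_range_succ, h]
  simp
  field_simp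

theorem gaussProd_add_two {ρ : ℝ} (hρ : ρ ∈ Set.Ioo (0 : ℝ) 1) (hirr : Irrational ρ) (n : ℕ) :
    gaussProd ρ (n + 2) = gaussProd ρ n - cfA ρ (n + 2) * gaussProd ρ (n + 1) := by
  have h := gaussMap_iterate_succ hρ hirr (n + 1)
  have h0 := (gaussMap_iterate_mem hρ hirr (n + 1)).1.1.ne'
  have e1 : gaussProd ρ (n + 2) = gaussProd ρ (n + 1) * gaussMap^[n + 2] ρ :=
    Finset.prod_range_succ _ _
  have e2 : gaussProd ρ (n + 1) = gaussProd ρ n * gaussMap^[n + 1] ρ :=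
    Finset.prod_range_succ _ _
  rw [e1, h, e2]
  field_simp

theorem cfQ_mul_sub_cfP {ρ : ℝ} (hρ : ρ ∈ Set.Ioo (0 : ℝ) 1) (hirr : Irrational ρ) (n : ℕ) :
    cfQ ρ n * ρ - cfP ρ n = (-1) ^ n * gaussProd ρ n := by
  induction n using Nat.twoStepInduction with
  | zero => simp [cfQ, cfP, gaussProd]
  | one => rw [gaussProd_one hρ hirr]; simp [cfQ, cfP]
  | more n h1 h2 =>
    rw [gaussProd_add_two hρ hirr, cfQ, cfP]
    push_cast
    linear_combination (cfA ρ (n + 2) : ℝ) * h2 + h1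

theorem cfQ_mul_gaussProd_add {ρ : ℝ} (hρ : ρ ∈ Set.Ioo (0 : ℝ) 1) (hirr : Irrational ρ) (n : ℕ) :
    cfQ ρ (n + 1) * gaussProd ρ n + cfQ ρ n * gaussProd ρ (n + 1) = 1 := by
  induction n with
  | zero => rw [gaussProd_one hρ hirr]; simp [cfQ, gaussProd]
  | succ n ih => rw [gaussProd_add_two hρ hirr, cfQ]; push_cast; linear_combination ih

theorem abs_cfQ_mul_sub_cfP_lt {ρ : ℝ} (hρ : ρ ∈ Set.Ioo (0 : ℝ) 1) (hirr : Irrational ρ)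
    (n : ℕ) : |cfQ ρ n * ρ - cfP ρ n| < 1 / cfQ ρ (n + 1) := by
  have hD := gaussProd_pos hρ hirr
  have hq : ∀ n, (0 : ℝ) < cfQ ρ n := fun n => by exact_mod_cast cfQ_pos hρ hirr n
  rw [cfQ_mul_sub_cfP hρ hirr, abs_mul, abs_pow, abs_neg, abs_one, one_pow, one_mul,
    abs_of_pos (hD n), lt_div_iff₀ (hq _)]
  nlinarith [cfQ_mul_gaussProd_add hρ hirr n, mul_pos (hq n) (hD (n + 1))]

/-- Arithmetic data of an irrational number `τ` of bounded type: rational approximations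
`p n / q n` whose denominators grow geometrically, and a Diophantine bound. -/
structure BoundedApprox (τ : ℝ) (q : ℕ → ℕ) (p : ℕ → ℤ) (L κ : ℝ) : Prop where
  q_pos : ∀ n, 0 < q n
  coprime : ∀ n, IsCoprime (p n) (q n : ℤ)
  approx : ∀ n, |q n * τ - p n| < 1 / q n
  κ_pos : 0 < κ
  q_succ_le : ∀ n, (q (n + 1) : ℝ) ≤ L * q n
  le_q_succ : ∀ n, 1 ≤ n → (1 + κ) * q n ≤ q (n + 1)
  exists_q : ∀ R : ℝ, 1 ≤ R → ∃ m, R < q m ∧ q m ≤ L * R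
  diophantine : ∀ i : ℕ, 1 ≤ i → ∀ s : ℤ, κ / i ≤ |i * τ - s|

theorem boundedApprox_cfQ {ρ : ℝ} (hρ : ρ ∈ Set.Ioo (0 : ℝ) 1) (hirr : Irrational ρ)
    (hbt : BoundedType ρ) (m : ℤ) :
    ∃ L κ : ℝ, BoundedApprox (ρ + m) (cfQ ρ) (fun n => cfP ρ n + m * cfQ ρ n) L κ := by
  obtain ⟨M, hM⟩ := hbt
  have hq : ∀ n, (0 : ℝ) < cfQ ρ n := fun n => by exact_mod_cast cfQ_pos hρ hirr n
  have hqs : ∀ n, (cfQ ρ n : ℝ) ≤ cfQ ρ (n + 1) := fun n => by exact_mod_cast cfQ_le_succ hρ hirr n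
  have hL : ∀ n, (cfQ ρ (n + 1) : ℝ) ≤ (M + 1) * cfQ ρ n := by
    intro n
    have hA : (cfA ρ (n + 1) : ℝ) ≤ M := by exact_mod_cast hM (n + 1) (by omega)
    cases n with
    | zero => simp only [zero_add] at hA; simp [cfQ]; linarith
    | succ n =>
      rw [cfQ]; push_cast
      nlinarith [hqs n, hq (n + 1)]
  have hM0 : (0 : ℝ) < M + 1 := by positivity
  have hgrow : ∀ n, 1 ≤ n → (1 + 1 / (4 * (M + 1) : ℝ)) * cfQ ρ n ≤ cfQ ρ (n + 1) := by
    intro n hn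
    obtain ⟨n, rfl⟩ := Nat.exists_eq_add_of_le' hn
    have h1 : (1 : ℝ) ≤ cfA ρ (n + 2) := by exact_mod_cast one_le_cfA hρ hirr (n + 1)
    have h2 : 1 / (4 * (M + 1) : ℝ) * cfQ ρ (n + 1) ≤ cfQ ρ n := by
      rw [one_div_mul_eq_div, div_le_iff₀ (by positivity)]
      nlinarith [hL n, hq n]
    rw [cfQ]; push_cast
    nlinarith [hq (n + 1)]
  have hunb : ∀ n : ℕ, n ≤ cfQ ρ (n + 1) := by
    intro n
    induction n with
    | zero => simp
    | succ n ih =>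
      rw [cfQ]
      nlinarith [one_le_cfA hρ hirr (n + 1), cfQ_pos hρ hirr n]
  have hex : ∀ R : ℝ, 1 ≤ R → ∃ m, R < cfQ ρ m ∧ cfQ ρ m ≤ (M + 1) * R := by
    intro R hR
    have hne : ∃ m, R < cfQ ρ m := by
      obtain ⟨n, hn⟩ := exists_nat_gt R
      exact ⟨n + 1, hn.trans_le (by exact_mod_cast hunb n)⟩
    classical
    refine ⟨Nat.find hne, Nat.find_spec hne, ?_⟩
    rcases h : Nat.find hne with _ | k
    · have := Nat.find_spec hne
      rw [h] at this
      simp [cfQ] at this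
      linarith
    · have h3 : ¬ R < cfQ ρ k := Nat.find_min hne (by omega)
      push Not at h3
      exact (hL k).trans (by gcongr)
  refine ⟨M + 1, 1 / (4 * (M + 1)), cfQ_pos hρ hirr, ?_, ?_, by positivity, hL, hgrow, hex, ?_⟩
  · intro n
    exact (isCoprime_cfP_cfQ ρ n).add_mul_right_left m
  · intro n
    have h := abs_cfQ_mul_sub_cfP_lt hρ hirr n
    have e : cfQ ρ n * (ρ + m) - ((cfP ρ n + m * cfQ ρ n : ℤ) : ℝ) = cfQ ρ n * ρ - cfP ρ n := by
      push_cast; ring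
    rw [e]
    exact h.trans_le (one_div_le_one_div_of_le (hq n) (hqs n))
  · intro i hi s
    have hi' : (1 : ℝ) ≤ i := by exact_mod_cast hi
    obtain ⟨n, hn1, hn2⟩ := hex (2 * i) (by linarith)
    set s' : ℤ := s - i * m
    have e : (i : ℝ) * (ρ + m) - s = i * ρ - s' := by simp [s']; ring
    rw [e]
    have hne : (i : ℤ) * cfP ρ n - s' * cfQ ρ n ≠ 0 := by
      intro h0
      have hdvd : (cfQ ρ n : ℤ) ∣ i :=
        (isCoprime_cfP_cfQ ρ n).symm.dvd_of_dvd_mul_right ⟨s', by linarith⟩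
      have := Nat.le_of_dvd hi (Int.natCast_dvd_natCast.1 hdvd)
      have : (cfQ ρ n : ℝ) ≤ i := by exact_mod_cast this
      linarith
    have h1 : (1 : ℝ) ≤ |(i : ℝ) * cfP ρ n - s' * cfQ ρ n| := by
      exact_mod_cast Int.one_le_abs hne
    have h2 := abs_cfQ_mul_sub_cfP_lt hρ hirr n
    rw [lt_div_iff₀ (hq _)] at h2
    have h3 : |(i : ℝ) * cfP ρ n - s' * cfQ ρ n| ≤
        cfQ ρ n * |i * ρ - s'| + i * |cfQ ρ n * ρ - cfP ρ n| := by
      have e2 : (i : ℝ) * cfP ρ n - s' * cfQ ρ n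
          = cfQ ρ n * (i * ρ - s') - i * (cfQ ρ n * ρ - cfP ρ n) := by ring
      rw [e2]
      refine (abs_sub _ _).trans ?_
      rw [abs_mul, abs_mul, Nat.abs_cast, Nat.abs_cast]
    have h4 : i * |cfQ ρ n * ρ - cfP ρ n| ≤ 1 / 2 := by
      nlinarith [hqs n, abs_nonneg (cfQ ρ n * ρ - cfP ρ n)]
    rw [div_div, div_le_iff₀ (by positivity)]
    nlinarith [abs_nonneg (i * ρ - s')]

namespace CircleDeg1Lift

theorem iterate_add_int (F : CircleDeg1Lift) (n : ℕ) (x : ℝ) (m : ℤ) :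
    F^[n] (x + m) = F^[n] x + m := by
  rw [← coe_pow]; exact (F ^ n).map_add_int x m

theorem iterate_sub_int (F : CircleDeg1Lift) (n : ℕ) (x : ℝ) (m : ℤ) :
    F^[n] (x - m) = F^[n] x - m := by
  rw [← coe_pow]; exact (F ^ n).map_sub_int x m

theorem abs_iterate_sub_le (F : CircleDeg1Lift) (n : ℕ) (x : ℝ) :
    |F^[n] x - n * F.translationNumber| ≤ |x| + 2 := by
  have h := F.dist_pow_map_zero_mul_translationNumber_le n
  rw [coe_pow, Real.dist_eq, abs_le] at h
  have h1 : F^[n] 0 + ⌊x⌋ ≤ F^[n] x := by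
    rw [← iterate_add_int]; exact F.monotone.iterate n (by simpa using Int.floor_le x)
  have h2 : F^[n] x ≤ F^[n] 0 + (⌊x⌋ + 1 : ℤ) := by
    rw [← iterate_add_int]
    exact F.monotone.iterate n (by simpa using (Int.lt_floor_add_one x).le)
  push_cast at h2
  have h3 := Int.floor_le x
  have h4 := Int.lt_floor_add_one x
  rw [abs_le]
  constructor <;> linarith [neg_abs_le x, le_abs_self x]

/-- A degree one monotone map is monotonically semiconjugate to the translation by its
translation number (the semiconjugacy need not be continuous or injective). -/
theorem exists_semiconj_translationNumber (F : CircleDeg1Lift) :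
    ∃ h : ℝ → ℝ, Monotone h ∧ (∀ x (m : ℤ), h (x + m) = h x + m) ∧
      ∀ x, h (F x) = h x + F.translationNumber := by
  set τ := F.translationNumber
  have hb : ∀ x, IsBoundedUnder (· ≤ ·) atTop (fun n : ℕ => F^[n] x - n * τ) := fun x =>
    ⟨|x| + 2, eventually_map.2 (Eventually.of_forall fun n =>
      (abs_le.1 (F.abs_iterate_sub_le n x)).2)⟩
  have hc : ∀ x, IsCoboundedUnder (· ≤ ·) atTop (fun n : ℕ => F^[n] x - n * τ) := fun x =>
    IsBoundedUnder.isCoboundedUnder_le ⟨-(|x| + 2), eventually_map.2 (Eventually.of_forall fun n =>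
      (abs_le.1 (F.abs_iterate_sub_le n x)).1)⟩
  refine ⟨fun x => limsup (fun n : ℕ => F^[n] x - n * τ) atTop, fun x y hxy => ?_, fun x m => ?_,
    fun x => ?_⟩
  · exact limsup_le_limsup (Eventually.of_forall fun n =>
      sub_le_sub_right (F.monotone.iterate n hxy) _) (hc x) (hb y)
  · have e : (fun n : ℕ => F^[n] (x + m) - n * τ) = fun n : ℕ => (F^[n] x - n * τ) + (m : ℝ) := by
      ext n
      rw [iterate_add_int]; ring
    dsimp only
    rw [e]
    exact limsup_add_const _ _ _ (hb x) (hc x)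
  · have e : (fun n : ℕ => F^[n] (F x) - n * τ)
        = fun n : ℕ => (F^[n + 1] x - (n + 1 : ℕ) * τ) + τ := by
      ext n
      rw [Function.iterate_succ_apply]; push_cast; ring
    have e' := limsup_nat_add (fun n : ℕ => F^[n] x - n * τ) 1
    dsimp only at e' ⊢
    rw [← e', e]
    refine limsup_add_const _ _ _ ⟨|x| + 2, eventually_map.2 (Eventually.of_forall fun n =>
      (abs_le.1 (F.abs_iterate_sub_le (n + 1) x)).2)⟩ ?_
    exact IsBoundedUnder.isCoboundedUnder_le ⟨-(|x| + 2), eventually_map.2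
      (Eventually.of_forall fun n => (abs_le.1 (F.abs_iterate_sub_le (n + 1) x)).1)⟩

end CircleDeg1Lift

/-- `h` is a monotone semiconjugacy of `F` to the translation by `τ`. -/
structure IsRotationCoord (F : CircleDeg1Lift) (τ : ℝ) (h : ℝ → ℝ) : Prop where
  mono : Monotone h
  add_int : ∀ x (m : ℤ), h (x + m) = h x + m
  semiconj : ∀ x, h (F x) = h x + τ

namespace IsRotationCoord

variable {F : CircleDeg1Lift} {τ : ℝ} {h : ℝ → ℝ}

theorem sub_int (H : IsRotationCoord F τ h) (x : ℝ) (m : ℤ) : h (x - m) = h x - m := by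
  have := H.add_int x (-m)
  push_cast at this
  simpa [sub_eq_add_neg] using this

theorem iterate (H : IsRotationCoord F τ h) (n : ℕ) (x : ℝ) : h (F^[n] x) = h x + n * τ := by
  induction n with
  | zero => simp
  | succ n ih => rw [Function.iterate_succ_apply', H.semiconj, ih]; push_cast; ring

theorem lt_of_lt (H : IsRotationCoord F τ h) {x y : ℝ} (hxy : h x < h y) : x < y :=
  H.mono.reflect_lt hxy

end IsRotationCoord

theorem exists_mul_sub_near {τ : ℝ} {q : ℕ} {p : ℤ} (hq : 0 < q) (hco : IsCoprime p (q : ℤ))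
    (happ : |q * τ - p| < 1 / q) (r : ℤ) :
    ∃ j < q, ∃ s : ℤ, j * p - s * q = r ∧ |j * τ - s - r / q| < 1 / q := by
  have hq' : (0 : ℝ) < q := by exact_mod_cast hq
  have hqz : (0 : ℤ) < q := by exact_mod_cast hq
  obtain ⟨u, v, huv⟩ := hco
  obtain ⟨j, hj⟩ := Int.eq_ofNat_of_zero_le (Int.emod_nonneg (r * u) hqz.ne')
  have hjq : (j : ℤ) < q := hj ▸ Int.emod_lt_of_pos _ hqz
  have hdm := Int.emod_add_mul_ediv (r * u) q
  rw [hj] at hdm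
  have hr : (j : ℤ) * p - (-(r * v) - (r * u / q) * p) * q = r := by
    linear_combination p * hdm + r * huv
  refine ⟨j, by exact_mod_cast hjq, _, hr, ?_⟩
  generalize -(r * v) - (r * u / q) * p = s at hr
  have hr' : (j : ℝ) * p - s * q = r := by exact_mod_cast hr
  have e : j * τ - s - r / q = j / q * (q * τ - p) := by
    field_simp
    linear_combination hr'
  have hjq' : (j : ℝ) / q ≤ 1 := (div_le_one hq').2 (by exact_mod_cast hjq.le)
  rw [e, abs_mul, abs_of_nonneg (by positivity : (0 : ℝ) ≤ j / q)]
  nlinarith [abs_nonneg (q * τ - p)]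

theorem birkhoffSum_eq_sum_sorted {F : CircleDeg1Lift} {τ : ℝ} {h : ℝ → ℝ}
    (H : IsRotationCoord F τ h) {q : ℕ} {p : ℤ} (hq : 0 < q) (hco : IsCoprime p (q : ℤ))
    (happ : |q * τ - p| < 1 / q) {φ : ℝ → ℝ} (hφ : ∀ x (m : ℤ), φ (x - m) = φ x) (z α : ℝ) :
    ∃ t : ℕ → ℝ, (∀ r, |h (t r) - (α + r / q)| < 2 / q) ∧
      birkhoffSum F φ q z = ∑ r ∈ Finset.range q, φ (t r) := by
  have hq' : (0 : ℝ) < q := by exact_mod_cast hq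
  set r₀ : ℤ := ⌊q * (α - h z)⌋ with hr₀
  choose j hj s hs hjs using fun r : ℕ => exists_mul_sub_near hq hco happ (r + r₀)
  refine ⟨fun r => F^[j r] z - s r, fun r => ?_, ?_⟩
  · rw [H.sub_int, H.iterate]
    have h1 := hjs r
    have h2 := Int.floor_le (q * (α - h z))
    have h3 := Int.lt_floor_add_one (q * (α - h z))
    rw [← hr₀] at h2 h3
    have h4 : (r₀ : ℝ) / q ≤ α - h z := by rw [div_le_iff₀ hq']; linarith
    have h5 : α - h z < r₀ / q + 1 / q := by
      rw [← add_div, lt_div_iff₀ hq']; linarith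
    push_cast at h1
    rw [add_div, abs_lt] at h1
    have h6 : (2 : ℝ) / q = 1 / q + 1 / q := by ring
    rw [abs_lt, h6]
    constructor <;> linarith [h1.1, h1.2]
  · simp only [hφ]
    have hinj : Set.InjOn j (Finset.range q) := by
      intro r hr r' hr' hrr
      simp only [Finset.coe_range, Set.mem_Iio] at hr hr'
      have e1 := hs r
      have e2 := hs r'
      rw [hrr] at e1
      have hdvd : (q : ℤ) ∣ r - r' := ⟨s r' - s r, by linarith⟩
      have := Int.eq_zero_of_abs_lt_dvd hdvd (by rw [abs_lt]; omega)
      omega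
    have himg : (Finset.range q).image j = Finset.range q := by
      apply Finset.eq_of_subset_of_card_le
      · intro x hx
        obtain ⟨r, -, rfl⟩ := Finset.mem_image.1 hx
        exact Finset.mem_range.2 (hj r)
      · rw [Finset.card_image_of_injOn hinj]
    rw [birkhoffSum, ← Finset.sum_image (f := fun i => φ (F^[i] z)) hinj, himg]

theorem sum_range_shift_four_sub (g : ℕ → ℝ) (n : ℕ) :
    ∑ r ∈ Finset.range n, (g (r + 4) - g r) =
      (g n - g 0) + (g (n + 1) - g 1) + (g (n + 2) - g 2) + (g (n + 3) - g 3) := by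
  induction n with
  | zero => simp
  | succ n ih => rw [Finset.sum_range_succ, ih]; ring_nf

/-- A function `φ` on the circle whose variation over a period is at most `W`. -/
structure PeriodicVariationLE (φ : ℝ → ℝ) (W : ℝ) : Prop where
  periodic : ∀ x (m : ℤ), φ (x - m) = φ x
  exists_dominating : ∃ V : ℝ → ℝ, (∀ x (m : ℕ), V (x + m) = V x + m * W) ∧
    ∀ x y, x ≤ y → |φ x - φ y| ≤ V y - V x

/-- A Denjoy–Koksma inequality for monotone degree one maps. -/
theorem abs_birkhoffSum_sub_le {F : CircleDeg1Lift} {τ : ℝ} {h : ℝ → ℝ}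
    (H : IsRotationCoord F τ h) {q : ℕ} {p : ℤ} (hq : 0 < q) (hco : IsCoprime p (q : ℤ))
    (happ : |q * τ - p| < 1 / q) {φ : ℝ → ℝ} {W : ℝ} (hφ : PeriodicVariationLE φ W) (x z : ℝ) :
    |birkhoffSum F φ q x - birkhoffSum F φ q z| ≤ 20 * W := by
  have hq1 : (1 : ℝ) ≤ q := by exact_mod_cast hq
  have hq' : (0 : ℝ) < q := by linarith
  obtain ⟨V, hVp, hV⟩ := hφ.exists_dominating
  obtain ⟨t, ht, hts⟩ := birkhoffSum_eq_sum_sorted H hq hco happ hφ.periodic x 0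
  obtain ⟨u, hu, hus⟩ := birkhoffSum_eq_sum_sorted H hq hco happ hφ.periodic z 0
  have hVm : Monotone V := fun x y hxy => by linarith [hV x y hxy, abs_nonneg (φ x - φ y)]
  set g : ℕ → ℝ := fun r => min (t r) (u r)
  have hg : ∀ r, |h (g r) - (0 + r / q)| < 2 / q := by
    intro r
    rcases min_choice (t r) (u r) with e | e <;> simp only [g, e]
    exacts [ht r, hu r]
  have hle : ∀ (y : ℝ) (r : ℕ), |h y - (0 + r / q)| < 2 / q → y ≤ g (r + 4) := by
    intro y r hy
    refine (H.lt_of_lt ?_).le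
    have h1 := abs_lt.1 hy
    have h2 := abs_lt.1 (hg (r + 4))
    push_cast at h2
    rw [add_div] at h2
    have : (4 : ℝ) / q = 2 / q + 2 / q := by ring
    linarith [h1.2, h2.1]
  have hterm : ∀ r, |φ (t r) - φ (u r)| ≤ V (g (r + 4)) - V (g r) := by
    intro r
    have h1 : V (t r) ≤ V (g (r + 4)) := hVm (hle _ _ (ht r))
    have h2 : V (u r) ≤ V (g (r + 4)) := hVm (hle _ _ (hu r))
    rcases le_total (t r) (u r) with hle' | hle'
    · have h3 : g r = t r := min_eq_left hle'
      rw [h3]; linarith [hV _ _ hle']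
    · have h3 : g r = u r := min_eq_right hle'
      rw [h3, abs_sub_comm]; linarith [hV _ _ hle']
  have hend : ∀ r, V (g (q + r)) - V (g r) ≤ 5 * W := by
    intro r
    have h1 := abs_lt.1 (hg (q + r))
    have h2 := abs_lt.1 (hg r)
    push_cast at h1
    rw [add_div, div_self hq'.ne'] at h1
    have h3 : (2 : ℝ) / q ≤ 2 := div_le_self (by norm_num) hq1
    have h4 : g (q + r) ≤ g r + (5 : ℕ) := by
      refine (H.lt_of_lt ?_).le
      have := H.add_int (g r) 5
      push_cast at this ⊢
      rw [this]
      linarith [h1.2, h2.1]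
    have h5 := hVm h4
    rw [hVp] at h5
    push_cast at h5
    linarith
  rw [hts, hus, ← Finset.sum_sub_distrib]
  calc |∑ r ∈ Finset.range q, (φ (t r) - φ (u r))|
      ≤ ∑ r ∈ Finset.range q, |φ (t r) - φ (u r)| := Finset.abs_sum_le_sum_abs _ _
    _ ≤ ∑ r ∈ Finset.range q, (V (g (r + 4)) - V (g r)) := Finset.sum_le_sum fun r _ => hterm r
    _ ≤ 20 * W := by
      rw [sum_range_shift_four_sub (fun r => V (g r))]
      have h0 := hend 0
      rw [add_zero] at h0
      linarith [hend 1, hend 2, hend 3]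

theorem mul_le_birkhoffSum_mul {α : Type*} (f : α → α) (φ : α → ℝ) (q : ℕ) {m : ℝ}
    (hm : ∀ x, m ≤ birkhoffSum f φ q x) (t : ℕ) (x : α) : t * m ≤ birkhoffSum f φ (t * q) x := by
  induction t with
  | zero => simp
  | succ t ih =>
    rw [add_mul, one_mul, birkhoffSum_add]
    push_cast
    linarith [hm (f^[t * q] x)]

theorem birkhoffSum_mul_le_mul {α : Type*} (f : α → α) (φ : α → ℝ) (q : ℕ) {m : ℝ}
    (hm : ∀ x, birkhoffSum f φ q x ≤ m) (t : ℕ) (x : α) : birkhoffSum f φ (t * q) x ≤ t * m := by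
  induction t with
  | zero => simp
  | succ t ih =>
    rw [add_mul, one_mul, birkhoffSum_add]
    push_cast
    linarith [hm (f^[t * q] x)]

/-- If the oscillation of the Birkhoff sums of lengths `q n` is at most `B`, these sums stay within
`B` of `q n * χ` for some `χ`. -/
theorem exists_birkhoff_mean {f : ℝ → ℝ} {φ : ℝ → ℝ} {q : ℕ → ℕ} (hq : ∀ n, 0 < q n) {B : ℝ}
    (hB : ∀ n x z, |birkhoffSum f φ (q n) x - birkhoffSum f φ (q n) z| ≤ B) :
    ∃ χ : ℝ, ∀ n x, |birkhoffSum f φ (q n) x - q n * χ| ≤ B := by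
  have hq' : ∀ n, (0 : ℝ) < q n := fun n => by exact_mod_cast hq n
  have key : ∀ (i j : ℕ × ℝ), (birkhoffSum f φ (q i.1) i.2 - B) / q i.1 ≤
      (birkhoffSum f φ (q j.1) j.2 + B) / q j.1 := by
    rintro ⟨n, x⟩ ⟨n', x'⟩
    have h1 := mul_le_birkhoffSum_mul f φ (q n) (m := birkhoffSum f φ (q n) x - B)
      (fun z => by linarith [(abs_le.1 (hB n x z)).2]) (q n') 0
    have h2 := birkhoffSum_mul_le_mul f φ (q n') (m := birkhoffSum f φ (q n') x' + B)
      (fun z => by linarith [(abs_le.1 (hB n' x' z)).1]) (q n) 0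
    rw [mul_comm (q n)] at h2
    rw [div_le_div_iff₀ (hq' _) (hq' _)]
    dsimp only
    linarith
  refine ⟨⨆ i : ℕ × ℝ, (birkhoffSum f φ (q i.1) i.2 - B) / q i.1, fun n x => ?_⟩
  have h1 := le_ciSup (f := fun i : ℕ × ℝ => (birkhoffSum f φ (q i.1) i.2 - B) / q i.1)
    ⟨_, by rintro _ ⟨i, rfl⟩; exact key i (0, 0)⟩ (n, x)
  have h2 := ciSup_le (f := fun i : ℕ × ℝ => (birkhoffSum f φ (q i.1) i.2 - B) / q i.1)
    fun i => key i (n, x)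
  dsimp only at h1
  rw [div_le_iff₀ (hq' n)] at h1
  rw [le_div_iff₀ (hq' n)] at h2
  rw [abs_le]
  constructor <;> linarith

/-- A degree one circle map which is flat on `[a, b]`, with derivative `D` increasing on
`[b, b + δ]`, decreasing on `[a + 1 - δ, a + 1]`, and at least `e₀` with `log D` Lipschitz in
between; the distance to the flat value is at least a power of the derivative. -/
structure FlatProfile (F : CircleDeg1Lift) (D : ℝ → ℝ) (a b δ e₀ Λ c₀ p : ℝ) : Prop where
  hasDerivAt : ∀ x, HasDerivAt F (D x) x
  lt : a < b
  δ_pos : 0 < δ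
  le_mid : b + δ ≤ a + 1 - δ
  e₀_pos : 0 < e₀
  e₀_le_one : e₀ ≤ 1
  map_eq : F a = F b
  flat : ∀ x ∈ Set.Icc a b, D x = 0
  pos : ∀ x ∈ Set.Ioo b (a + 1), 0 < D x
  incr : MonotoneOn D (Set.Icc b (b + δ))
  decr : AntitoneOn D (Set.Icc (a + 1 - δ) (a + 1))
  mid : ∀ x ∈ Set.Icc (b + δ) (a + 1 - δ), e₀ ≤ D x
  lip : ∀ x ∈ Set.Icc (b + δ) (a + 1 - δ), ∀ y ∈ Set.Icc (b + δ) (a + 1 - δ),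
    |Real.log (D x) - Real.log (D y)| ≤ Λ * |x - y|
  c₀_pos : 0 < c₀
  p_nonneg : 0 ≤ p
  far : ∀ x ∈ Set.Ioo b (a + 1), c₀ * D x ^ p ≤ F x - F b ∧ c₀ * D x ^ p ≤ F b + 1 - F x

/-- The logarithm of `D`, truncated from below at `log ε`. -/
noncomputable def truncLog (D : ℝ → ℝ) (ε x : ℝ) : ℝ := Real.log (max (D x) ε)

theorem PeriodicVariationLE.of_Icc {φ V : ℝ → ℝ} {b : ℝ} (hφ : ∀ x (m : ℤ), φ (x - m) = φ x)
    (hV : ∀ x y, b ≤ x → x ≤ y → y ≤ b + 1 → |φ x - φ y| ≤ V y - V x) :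
    PeriodicVariationLE φ (V (b + 1) - V b) := by
  set W := V (b + 1) - V b with hWdef
  have hW : 0 ≤ W := (abs_nonneg _).trans (hV b (b + 1) le_rfl (by linarith) le_rfl)
  refine ⟨hφ, fun x => V (x - ⌊x - b⌋) + ⌊x - b⌋ * W, fun x m => ?_, fun x y hxy => ?_⟩
  · have e : ⌊x + m - b⌋ = ⌊x - b⌋ + m := by
      rw [add_sub_right_comm]; exact Int.floor_add_natCast _ _
    have e2 : x + m - (⌊x - b⌋ + m : ℝ) = x - ⌊x - b⌋ := by ring
    dsimp only
    rw [e]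
    push_cast
    rw [e2]
    ring
  · have hx1 := Int.floor_le (x - b)
    have hx2 := Int.lt_floor_add_one (x - b)
    have hy1 := Int.floor_le (y - b)
    have hy2 := Int.lt_floor_add_one (y - b)
    have hnm : ⌊x - b⌋ ≤ ⌊y - b⌋ := Int.floor_le_floor (by linarith)
    rw [← hφ x ⌊x - b⌋, ← hφ y ⌊y - b⌋]
    dsimp only
    rcases hnm.eq_or_lt with h | h
    · rw [← h] at hy1 hy2 ⊢
      linarith [hV (x - ⌊x - b⌋) (y - ⌊x - b⌋) (by linarith) (by linarith) (by linarith)]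
    · have h' : (⌊x - b⌋ : ℝ) + 1 ≤ ⌊y - b⌋ := by exact_mod_cast h
      have h1 := hV (x - ⌊x - b⌋) (b + 1) (by linarith) (by linarith) le_rfl
      have h2 := hV b (y - ⌊y - b⌋) le_rfl (by linarith) (by linarith)
      have h3 : φ (b + 1) = φ b := by
        have := hφ (b + 1) 1
        push_cast at this
        rw [← this]; congr 1; ring
      rw [h3] at h1
      have h4 := abs_sub_le (φ (x - ⌊x - b⌋)) (φ b) (φ (y - ⌊y - b⌋))
      nlinarith

namespace FlatProfile

variable {F : CircleDeg1Lift} {D : ℝ → ℝ} {a b δ e₀ Λ c₀ p : ℝ}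

theorem D_sub_int (P : FlatProfile F D a b δ e₀ Λ c₀ p) (x : ℝ) (m : ℤ) : D (x - m) = D x := by
  have h1 : HasDerivAt (fun y => F (y - m) + m) (D (x - m)) x :=
    ((P.hasDerivAt (x - m)).comp_sub_const x m).add_const _
  have h2 : (fun y => F (y - m) + (m : ℝ)) = F := by
    ext y; rw [F.map_sub_int]; ring
  rw [h2] at h1
  exact h1.unique (P.hasDerivAt x)

theorem exists_sub_int_mem (P : FlatProfile F D a b δ e₀ Λ c₀ p) (x : ℝ) :
    ∃ s : ℤ, x - s ∈ Set.Icc a b ∨ x - s ∈ Set.Ioo b (a + 1) := by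
  have h1 := Int.floor_le (x - b)
  have h2 := Int.lt_floor_add_one (x - b)
  rcases lt_or_ge (x - ⌊x - b⌋) (a + 1) with h | h
  · refine ⟨⌊x - b⌋, ?_⟩
    rcases eq_or_lt_of_le (show b ≤ x - ⌊x - b⌋ by linarith) with h' | h'
    · exact Or.inl ⟨by linarith [P.lt], h'.ge⟩
    · exact Or.inr ⟨h', h⟩
  · refine ⟨⌊x - b⌋ + 1, Or.inl ⟨?_, ?_⟩⟩ <;> push_cast <;> linarith

theorem D_nonneg (P : FlatProfile F D a b δ e₀ Λ c₀ p) (x : ℝ) : 0 ≤ D x := by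
  obtain ⟨s, hs | hs⟩ := P.exists_sub_int_mem x <;> rw [← P.D_sub_int x s]
  exacts [(P.flat _ hs).ge, (P.pos _ hs).le]

theorem exists_sub_int_mem_Ioo (P : FlatProfile F D a b δ e₀ Λ c₀ p) {x : ℝ} (hx : 0 < D x) :
    ∃ s : ℤ, x - s ∈ Set.Ioo b (a + 1) := by
  obtain ⟨s, hs | hs⟩ := P.exists_sub_int_mem x
  · rw [← P.D_sub_int x s, P.flat _ hs] at hx
    exact absurd hx (lt_irrefl _)
  · exact ⟨s, hs⟩

theorem min_le_of_mem_Icc (P : FlatProfile F D a b δ e₀ Λ c₀ p) {u v y ε : ℝ} (hu : b < u)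
    (huy : u ≤ y) (hyv : y ≤ v) (hv : v < a + 1) (h0 : ε ≤ e₀) (h1 : ε ≤ D u) (h2 : ε ≤ D v) :
    ε ≤ D y := by
  rcases le_total y (b + δ) with h | h
  · exact h1.trans (P.incr ⟨hu.le, by linarith⟩ ⟨by linarith, h⟩ huy)
  rcases le_total y (a + 1 - δ) with h' | h'
  · exact h0.trans (P.mid _ ⟨h, h'⟩)
  · exact h2.trans (P.decr ⟨h', by linarith⟩ ⟨by linarith, hv.le⟩ hyv)

theorem far_int (P : FlatProfile F D a b δ e₀ Λ c₀ p) {y : ℝ} (hy : 0 < D y) (m : ℤ) :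
    c₀ * D y ^ p ≤ |F y - F b - m| := by
  obtain ⟨s, hs⟩ := P.exists_sub_int_mem_Ioo hy
  obtain ⟨h1, h2⟩ := P.far _ hs
  rw [P.D_sub_int, F.map_sub_int] at h1 h2
  rcases le_or_gt m s with h | h
  · have : (m : ℝ) ≤ s := by exact_mod_cast h
    exact (by linarith : _ ≤ F y - F b - m).trans (le_abs_self _)
  · have : (s : ℝ) + 1 ≤ m := by exact_mod_cast h
    exact (by linarith : _ ≤ -(F y - F b - m)).trans (neg_le_abs _)

theorem truncLog_sub_int (P : FlatProfile F D a b δ e₀ Λ c₀ p) (ε x : ℝ) (m : ℤ) :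
    truncLog D ε (x - m) = truncLog D ε x := by
  rw [truncLog, truncLog, P.D_sub_int]

theorem exists_variation_bound (P : FlatProfile F D a b δ e₀ Λ c₀ p) :
    ∃ C : ℝ, ∀ ε, 0 < ε → ε ≤ e₀ → PeriodicVariationLE (truncLog D ε) (C - 2 * Real.log ε) := by
  refine ⟨Real.log (D (b + δ)) + Λ * (a + 1 - δ - (b + δ)) + Real.log (D (a + 1 - δ)),
    fun ε hε hεe => ?_⟩
  have hδ := P.δ_pos
  have hmidle := P.le_mid
  have hab := P.lt
  set φ := truncLog D ε with hφdef
  have hmon : ∀ {x y}, D x ≤ D y → φ x ≤ φ y := fun {x y} h =>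
    Real.log_le_log (lt_max_of_lt_right hε) (max_le_max_right _ h)
  have hmid : ∀ x ∈ Set.Icc (b + δ) (a + 1 - δ), φ x = Real.log (D x) := fun x hx => by
    rw [hφdef, truncLog, max_eq_left (hεe.trans (P.mid x hx))]
  have hzero : ∀ x, D x = 0 → φ x = Real.log ε := fun x hx => by
    rw [hφdef, truncLog, hx, max_eq_right hε.le]
  have hdecr : AntitoneOn φ (Set.Icc (a + 1 - δ) (b + 1)) := by
    intro x hx y hy hxy
    apply hmon
    rcases le_total y (a + 1) with h | h
    · exact P.decr ⟨hx.1, by linarith⟩ ⟨hy.1, h⟩ hxy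
    · have : D y = 0 := by
        rw [← P.D_sub_int y 1]
        exact P.flat _ ⟨by push_cast; linarith, by push_cast; linarith [hy.2]⟩
      rw [this]
      exact P.D_nonneg x
  set cl : ℝ → ℝ := fun x => max (b + δ) (min x (a + 1 - δ)) with hcl
  have hclm : Monotone cl := fun x y h => max_le_max_left _ (min_le_min_right _ h)
  have hclmem : ∀ x, cl x ∈ Set.Icc (b + δ) (a + 1 - δ) := fun x =>
    ⟨le_max_left _ _, max_le hmidle (min_le_right _ _)⟩
  set V : ℝ → ℝ := fun x => φ (min x (b + δ)) + Λ * cl x - φ (max x (a + 1 - δ)) with hVdef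
  have hdec : ∀ x, φ x = φ (min x (b + δ)) + φ (cl x) + φ (max x (a + 1 - δ))
      - φ (b + δ) - φ (a + 1 - δ) := by
    intro x
    simp only [hcl]
    rcases le_total x (b + δ) with h | h
    · rw [min_eq_left h, min_eq_left (by linarith : x ≤ a + 1 - δ), max_eq_left h,
        max_eq_right (by linarith : x ≤ a + 1 - δ)]
      ring
    rcases le_total x (a + 1 - δ) with h' | h'
    · rw [min_eq_right h, min_eq_left h', max_eq_right h, max_eq_right h']
      ring
    · rw [min_eq_right h, min_eq_right h', max_eq_right hmidle, max_eq_left h']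
      ring
  have hV : ∀ x y, b ≤ x → x ≤ y → y ≤ b + 1 → |φ x - φ y| ≤ V y - V x := by
    intro x y hx hxy hy
    have h1 : φ (min x (b + δ)) ≤ φ (min y (b + δ)) :=
      hmon (P.incr ⟨le_min hx (by linarith), min_le_right _ _⟩
        ⟨le_min (by linarith) (by linarith), min_le_right _ _⟩ (min_le_min_right _ hxy))
    have h2 : φ (max y (a + 1 - δ)) ≤ φ (max x (a + 1 - δ)) :=
      hdecr ⟨le_max_right _ _, max_le (by linarith) (by linarith)⟩
        ⟨le_max_right _ _, max_le hy (by linarith)⟩ (max_le_max_right _ hxy)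
    have h3 := P.lip _ (hclmem x) _ (hclmem y)
    rw [← hmid _ (hclmem x), ← hmid _ (hclmem y), abs_sub_comm (cl x),
      abs_of_nonneg (sub_nonneg.2 (hclm hxy)), abs_le] at h3
    rw [abs_le, hdec x, hdec y]
    simp only [hVdef]
    constructor <;> linarith [h3.1, h3.2]
  have h := PeriodicVariationLE.of_Icc (P.truncLog_sub_int ε) hV
  have e1 : min (b + 1) (b + δ) = b + δ := min_eq_right (by linarith)
  have e2 : min b (b + δ) = b := min_eq_left (by linarith)
  have e3 : max (b + 1) (a + 1 - δ) = b + 1 := max_eq_left (by linarith)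
  have e4 : max b (a + 1 - δ) = a + 1 - δ := max_eq_right (by linarith)
  have e5 : cl (b + 1) = a + 1 - δ := by
    simp only [hcl]
    rw [min_eq_right (by linarith), max_eq_right hmidle]
  have e6 : cl b = b + δ := by
    simp only [hcl]
    rw [min_eq_left (by linarith), max_eq_left (by linarith)]
  have e7 : φ b = Real.log ε := hzero _ (P.flat _ ⟨hab.le, le_rfl⟩)
  have e8 : φ (b + 1) = Real.log ε := by
    apply hzero
    rw [← P.D_sub_int (b + 1) 1]
    exact P.flat _ ⟨by push_cast; linarith, by push_cast; linarith⟩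
  have e9 : V (b + 1) - V b = Real.log (D (b + δ)) + Λ * (a + 1 - δ - (b + δ))
      + Real.log (D (a + 1 - δ)) - 2 * Real.log ε := by
    simp only [hVdef, e1, e2, e3, e4, e5, e6, e7, e8, hmid _ ⟨le_rfl, hmidle⟩,
      hmid _ ⟨hmidle, le_rfl⟩]
    ring
  rwa [e9] at h

end FlatProfile

/-- The smaller of `e₀` and the least derivative at the points `F^[i] b`, `1 ≤ i ≤ N`. -/
noncomputable def minDeriv (F D : ℝ → ℝ) (b e₀ : ℝ) : ℕ → ℝ
  | 0 => e₀
  | N + 1 => min (minDeriv F D b e₀ N) (D (F^[N + 1] b))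

theorem minDeriv_antitone (F D : ℝ → ℝ) (b e₀ : ℝ) : Antitone (minDeriv F D b e₀) :=
  antitone_nat_of_succ_le fun _ => min_le_left _ _

theorem minDeriv_le (F D : ℝ → ℝ) (b e₀ : ℝ) (N : ℕ) : minDeriv F D b e₀ N ≤ e₀ :=
  minDeriv_antitone F D b e₀ (Nat.zero_le N)

theorem minDeriv_le_apply (F D : ℝ → ℝ) (b e₀ : ℝ) {i N : ℕ} (hi : 1 ≤ i) (hiN : i ≤ N) :
    minDeriv F D b e₀ N ≤ D (F^[i] b) := by
  obtain ⟨i, rfl⟩ := Nat.exists_eq_add_of_le' hi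
  exact (minDeriv_antitone F D b e₀ hiN).trans (min_le_right _ _)

theorem exists_eq_minDeriv (F D : ℝ → ℝ) (b e₀ : ℝ) (N : ℕ) (hN : minDeriv F D b e₀ N < e₀) :
    ∃ i, 1 ≤ i ∧ i ≤ N ∧ minDeriv F D b e₀ N = D (F^[i] b) := by
  induction N with
  | zero => exact absurd hN (lt_irrefl _)
  | succ N ih =>
    rcases min_choice (minDeriv F D b e₀ N) (D (F^[N + 1] b)) with h | h
    · have h' : minDeriv F D b e₀ (N + 1) = minDeriv F D b e₀ N := h
      rw [h'] at hN ⊢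
      obtain ⟨i, h1, h2, h3⟩ := ih hN
      exact ⟨i, h1, by omega, h3⟩
    · exact ⟨N + 1, by omega, le_rfl, h⟩

theorem exists_closest_multiple (τ : ℝ) {Q : ℕ} (hQ : 1 ≤ Q) :
    ∃ i, 1 ≤ i ∧ i ≤ Q ∧ ∃ m : ℤ, ∀ j : ℕ, 1 ≤ j → j ≤ Q → ∀ N : ℤ,
      |i * τ - m| ≤ |j * τ - N| := by
  obtain ⟨i, hi, hmin⟩ := Finset.exists_min_image (Finset.Icc 1 Q)
    (fun i : ℕ => |i * τ - round (i * τ)|) ⟨1, Finset.mem_Icc.2 ⟨le_rfl, hQ⟩⟩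
  rw [Finset.mem_Icc] at hi
  exact ⟨i, hi.1, hi.2, round (i * τ), fun j h1 h2 N =>
    (hmin j (Finset.mem_Icc.2 ⟨h1, h2⟩)).trans (round_le _ _)⟩

theorem hasDerivAt_iterate_of_forall {F D : ℝ → ℝ} (h : ∀ x, HasDerivAt F (D x) x) (n : ℕ) (x : ℝ) :
    HasDerivAt F^[n] (∏ j ∈ Finset.range n, D (F^[j] x)) x := by
  induction n with
  | zero => simpa using hasDerivAt_id x
  | succ n ih =>
    rw [Function.iterate_succ', Finset.prod_range_succ, mul_comm]
    exact (h _).comp x ih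

namespace FlatProfile

variable {F : CircleDeg1Lift} {D h : ℝ → ℝ} {a b δ e₀ Λ c₀ p τ L κ : ℝ} {q : ℕ → ℕ} {pn : ℕ → ℤ}

theorem coord_eq (P : FlatProfile F D a b δ e₀ Λ c₀ p) (H : IsRotationCoord F τ h) {x : ℝ}
    (hx : x ∈ Set.Icc a b) : h x = h b := by
  have h1 := H.semiconj a
  rw [P.map_eq, H.semiconj b] at h1
  exact le_antisymm (H.mono hx.2) (by linarith [H.mono hx.1])

theorem coord_add_one (P : FlatProfile F D a b δ e₀ Λ c₀ p) (H : IsRotationCoord F τ h) :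
    h (a + 1) = h b + 1 := by
  have := H.add_int a 1
  push_cast at this
  rw [this, P.coord_eq H ⟨le_rfl, P.lt.le⟩]

theorem D_iterate_pos (P : FlatProfile F D a b δ e₀ Λ c₀ p) (H : IsRotationCoord F τ h)
    (A : BoundedApprox τ q pn L κ) {i : ℕ} (hi : 1 ≤ i) : 0 < D (F^[i] b) := by
  obtain ⟨s, hs | hs⟩ := P.exists_sub_int_mem (F^[i] b)
  · have h1 := P.coord_eq H hs
    rw [H.sub_int, H.iterate] at h1
    have h2 := A.diophantine i hi s
    have h3 : (i : ℝ) * τ - s = 0 := by linarith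
    have : 0 < κ / i := div_pos A.κ_pos (by exact_mod_cast hi)
    rw [h3, abs_zero] at h2
    linarith
  · rw [← P.D_sub_int _ s]
    exact P.pos _ hs

theorem minDeriv_pos (P : FlatProfile F D a b δ e₀ Λ c₀ p) (H : IsRotationCoord F τ h)
    (A : BoundedApprox τ q pn L κ) (N : ℕ) : 0 < minDeriv F D b e₀ N := by
  induction N with
  | zero => exact P.e₀_pos
  | succ N ih => exact lt_min ih (P.D_iterate_pos H A (by omega))

theorem log_prod_eq_birkhoffSum {ε x : ℝ} {n : ℕ} (hD : ∀ j < n, 0 < D (F^[j] x) ∧ ε ≤ D (F^[j] x)) :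
    Real.log (∏ j ∈ Finset.range n, D (F^[j] x)) = birkhoffSum F (truncLog D ε) n x := by
  rw [Real.log_prod fun j hj => (hD j (Finset.mem_range.1 hj)).1.ne']
  refine Finset.sum_congr rfl fun j hj => ?_
  rw [truncLog, max_eq_left (hD j (Finset.mem_range.1 hj)).2]

theorem exists_birkhoffSum_nonneg (P : FlatProfile F D a b δ e₀ Λ c₀ p) (ε : ℝ) (n : ℕ) :
    ∃ x, 0 ≤ birkhoffSum F (truncLog D ε) n x := by
  have hd := hasDerivAt_iterate_of_forall P.hasDerivAt n
  obtain ⟨x, -, hx⟩ := exists_hasDerivAt_eq_slope (F^[n]) _ zero_lt_one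
    (fun x _ => (hd x).continuousAt.continuousWithinAt) (fun x _ => hd x)
  have h1 := F.iterate_add_int n 0 1
  simp only [Int.cast_one, zero_add] at h1
  rw [h1] at hx
  have h2 : ∏ j ∈ Finset.range n, D (F^[j] x) = 1 := by rw [hx]; ring
  refine ⟨x, ?_⟩
  have h3 : ∀ j ∈ Finset.range n, D (F^[j] x) ≠ 0 :=
    Finset.prod_ne_zero_iff.1 (by rw [h2]; exact one_ne_zero)
  rw [← Real.log_one, ← h2, Real.log_prod h3]
  refine Finset.sum_le_sum fun j hj => Real.log_le_log ?_ (le_max_left _ _)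
  exact lt_of_le_of_ne (P.D_nonneg _) (h3 j hj).symm

theorem exists_birkhoffSum_le_of_avoid (P : FlatProfile F D a b δ e₀ Λ c₀ p)
    (H : IsRotationCoord F τ h) {Q : ℕ} (hQ : 1 ≤ Q) {u v ε : ℝ} (huv : u < v) (hε : 0 < ε)
    (hεe : ε ≤ e₀) (hu : ∀ j < Q, ε ≤ D (F^[j] u)) (hv : ∀ j < Q, ε ≤ D (F^[j] v))
    (havoid : ∀ j < Q, ∀ N : ℤ, ¬ (h u + j * τ ≤ h b + N ∧ h b + N ≤ h v + j * τ))
    (hlen : c₀ * ε ^ p ≤ v - u) :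
    ∃ x, birkhoffSum F (truncLog D ε) Q x ≤ -Real.log c₀ - p * Real.log ε := by
  have hloc : ∀ j < Q, ∃ s : ℤ, b < F^[j] u - s ∧ F^[j] v - s < a + 1 := by
    intro j hj
    obtain ⟨s, hs1, hs2⟩ := P.exists_sub_int_mem_Ioo (hε.trans_le (hu j hj))
    refine ⟨s, hs1, ?_⟩
    by_contra hcon
    push Not at hcon
    refine havoid j hj (s + 1) ⟨?_, ?_⟩
    · have := H.mono hs2.le
      rw [P.coord_add_one H, H.sub_int, H.iterate] at this
      push_cast; linarith
    · have := H.mono hcon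
      rw [P.coord_add_one H, H.sub_int, H.iterate] at this
      push_cast; linarith
  have hD : ∀ y, u ≤ y → y ≤ v → ∀ j < Q, ε ≤ D (F^[j] y) := by
    intro y huy hyv j hj
    obtain ⟨s, hs1, hs2⟩ := hloc j hj
    have h1 := F.monotone.iterate j huy
    have h2 := F.monotone.iterate j hyv
    rw [← P.D_sub_int _ s]
    refine P.min_le_of_mem_Icc hs1 (by linarith) (by linarith) hs2 hεe ?_ ?_
    · rw [P.D_sub_int]; exact hu j hj
    · rw [P.D_sub_int]; exact hv j hj
  have hd := hasDerivAt_iterate_of_forall P.hasDerivAt Q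
  obtain ⟨x, hx, hx'⟩ := exists_hasDerivAt_eq_slope (F^[Q]) _ huv
    (fun x _ => (hd x).continuousAt.continuousWithinAt) (fun x _ => hd x)
  have hDx := hD x hx.1.le hx.2.le
  refine ⟨x, ?_⟩
  rw [← log_prod_eq_birkhoffSum fun j hj => ⟨hε.trans_le (hDx j hj), hDx j hj⟩]
  have hc : 0 < c₀ * ε ^ p := mul_pos P.c₀_pos (Real.rpow_pos_of_pos hε p)
  have hle : F^[Q] v - F^[Q] u ≤ 1 := by
    obtain ⟨s, hs1, hs2⟩ := hloc 0 hQ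
    simp only [Function.iterate_zero, id] at hs1 hs2
    have h1 := F.iterate_add_int Q u 1
    push_cast at h1
    have h2 : F^[Q] v ≤ F^[Q] (u + 1) := F.monotone.iterate Q (by linarith [P.lt])
    linarith
  have hprod : ∏ j ∈ Finset.range Q, D (F^[j] x) ≤ (c₀ * ε ^ p)⁻¹ := by
    rw [hx', ← one_div]
    gcongr
  calc Real.log (∏ j ∈ Finset.range Q, D (F^[j] x))
      ≤ Real.log (c₀ * ε ^ p)⁻¹ := Real.log_le_log
        (Finset.prod_pos fun j hj => hε.trans_le (hDx j (Finset.mem_range.1 hj))) hprod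
    _ = _ := by
      rw [Real.log_inv, Real.log_mul P.c₀_pos.ne' (Real.rpow_pos_of_pos hε p).ne',
        Real.log_rpow hε]
      ring

theorem exists_birkhoffSum_le (P : FlatProfile F D a b δ e₀ Λ c₀ p)
    (H : IsRotationCoord F τ h) (A : BoundedApprox τ q pn L κ) {Q : ℕ} (hQ : 1 ≤ Q) :
    ∃ x, birkhoffSum F (truncLog D (minDeriv F D b e₀ (2 * Q))) Q x ≤
      -Real.log c₀ - p * Real.log (minDeriv F D b e₀ (2 * Q)) := by
  set ε := minDeriv F D b e₀ (2 * Q) with hεdef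
  have hε : 0 < ε := P.minDeriv_pos H A _
  have hεe : ε ≤ e₀ := minDeriv_le _ _ _ _ _
  obtain ⟨i, hi1, hiQ, m, hmin⟩ := exists_closest_multiple τ hQ
  have hne : ∀ i : ℕ, 1 ≤ i → ∀ s : ℤ, (i : ℝ) * τ - s ≠ 0 := by
    intro i hi s h0
    have h1 := A.diophantine i hi s
    have h2 : 0 < κ / i := div_pos A.κ_pos (by exact_mod_cast hi)
    rw [h0, abs_zero] at h1
    linarith
  set x₁ := F^[i] (F b) - m with hx₁
  have hh0 : h (F b) = h b + τ := H.semiconj b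
  have hh1 : h x₁ = h b + τ + (i * τ - m) := by rw [hx₁, H.sub_int, H.iterate, hh0]; ring
  have hD0 : ∀ j < Q, ε ≤ D (F^[j] (F b)) := by
    intro j hj
    rw [← Function.iterate_succ_apply]
    exact minDeriv_le_apply _ _ _ _ (by omega) (by omega)
  have hD1 : ∀ j < Q, ε ≤ D (F^[j] x₁) := by
    intro j hj
    rw [hx₁, F.iterate_sub_int, P.D_sub_int, ← Function.iterate_add_apply,
      ← Function.iterate_succ_apply]
    exact minDeriv_le_apply _ _ _ _ (by omega) (by omega)
  have hdist : c₀ * ε ^ p ≤ |x₁ - F b| := by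
    have h1 : 0 < D (F^[i] b) := P.D_iterate_pos H A hi1
    have h2 := P.far_int h1 m
    have h3 : ε ≤ D (F^[i] b) := minDeriv_le_apply _ _ _ _ hi1 (by omega)
    have h4 : x₁ - F b = F (F^[i] b) - F b - m := by
      rw [hx₁, ← Function.iterate_succ_apply, Function.iterate_succ_apply']; ring
    rw [h4]
    refine le_trans ?_ h2
    have := P.c₀_pos
    have := P.p_nonneg
    gcongr
  rcases lt_or_gt_of_ne (hne i hi1 m) with hlt | hgt
  · have hlt' : x₁ < F b := H.lt_of_lt (by linarith)
    refine P.exists_birkhoffSum_le_of_avoid H hQ hlt' hε hεe hD1 hD0 ?_ ?_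
    · rintro j hj N ⟨hN1, hN2⟩
      rw [hh1] at hN1
      rw [hh0] at hN2
      have h1 := hmin (j + 1) (by omega) hj N
      have h2 := hne (j + 1 + i) (by omega) (N + m)
      push_cast at h1 h2
      rw [abs_of_neg hlt, abs_of_nonneg (by linarith)] at h1
      exact h2 (by linarith)
    · rwa [abs_of_neg (by linarith), neg_sub] at hdist
  · have hgt' : F b < x₁ := H.lt_of_lt (by linarith)
    refine P.exists_birkhoffSum_le_of_avoid H hQ hgt' hε hεe hD0 hD1 ?_ ?_
    · rintro j hj N ⟨hN1, hN2⟩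
      rw [hh0] at hN1
      rw [hh1] at hN2
      have h1 := hmin (j + 1) (by omega) hj N
      have h2 := hne (j + 1 + i) (by omega) (N + m)
      push_cast at h1 h2
      rw [abs_of_pos hgt, abs_of_nonpos (by linarith)] at h1
      exact h2 (by linarith)
    · rwa [abs_of_pos (by linarith)] at hdist

theorem exists_lt_D_iterate_le (P : FlatProfile F D a b δ e₀ Λ c₀ p)
    (H : IsRotationCoord F τ h) (A : BoundedApprox τ q pn L κ) {N m : ℕ}
    (hlt : minDeriv F D b e₀ N < e₀) (hm : 3 * N / κ < q m) (x : ℝ) :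
    ∃ j < q m, D (F^[j] x) ≤ minDeriv F D b e₀ N := by
  obtain ⟨i, hi1, hiN, hi⟩ := exists_eq_minDeriv _ _ _ _ _ hlt
  have hκ := A.κ_pos
  have hqm : (0 : ℝ) < q m := by exact_mod_cast A.q_pos m
  have hi0 : (0 : ℝ) < i := by exact_mod_cast hi1
  have hw : ∀ s : ℤ, 3 / q m < |i * τ - s| := by
    intro s
    refine lt_of_lt_of_le ?_ (A.diophantine i hi1 s)
    have hiN' : (i : ℝ) ≤ N := by exact_mod_cast hiN
    rw [div_lt_iff₀ hκ] at hm
    rw [div_lt_div_iff₀ hqm hi0]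
    nlinarith
  have hvisit : ∀ α : ℝ, ∃ j < q m, ∃ s : ℤ,
      α < h (F^[j] x - s) ∧ h (F^[j] x - s) ≤ α + 3 / q m := by
    intro α
    obtain ⟨j, hj, s, -, hjs⟩ := exists_mul_sub_near (A.q_pos m) (A.coprime m) (A.approx m)
      (⌊(α - h x) * q m⌋ + 2)
    refine ⟨j, hj, s, ?_⟩
    have h1 := Int.floor_le ((α - h x) * q m)
    have h2 := Int.lt_floor_add_one ((α - h x) * q m)
    set r := ⌊(α - h x) * q m⌋
    have h3 : (r : ℝ) / q m ≤ α - h x := (div_le_iff₀ hqm).2 h1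
    have h4 : α - h x < r / q m + 1 / q m := by
      rw [← add_div]; exact (lt_div_iff₀ hqm).2 h2
    push_cast at hjs
    rw [add_div, abs_lt] at hjs
    have h5 : (2 : ℝ) / q m = 1 / q m + 1 / q m := by ring
    have h6 : (3 : ℝ) / q m = 1 / q m + 1 / q m + 1 / q m := by ring
    rw [H.sub_int, H.iterate, h6]
    rw [h5] at hjs
    constructor <;> linarith [hjs.1, hjs.2]
  rw [hi] at hlt ⊢
  obtain ⟨s, hs⟩ := P.exists_sub_int_mem_Ioo (P.D_iterate_pos H A hi1)
  set y := F^[i] b - s with hy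
  have hDy : D y = D (F^[i] b) := P.D_sub_int _ _
  have hhy : h y = h b + (i * τ - s) := by rw [hy, H.sub_int, H.iterate]; ring
  rw [← hDy] at hlt ⊢
  rcases lt_or_ge y (b + δ) with hyb | hyb
  · have hpos : 0 ≤ (i : ℝ) * τ - s := by linarith [H.mono hs.1.le]
    have h3 := hw s
    rw [abs_of_nonneg hpos] at h3
    obtain ⟨j, hj, t, ht1, ht2⟩ := hvisit (h b)
    have h4 := H.lt_of_lt ht1
    have h5 : F^[j] x - t < y := H.lt_of_lt (by linarith)
    refine ⟨j, hj, ?_⟩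
    rw [← P.D_sub_int _ t]
    exact P.incr ⟨h4.le, by linarith⟩ ⟨hs.1.le, hyb.le⟩ h5.le
  · have hya : a + 1 - δ < y := by
      by_contra hcon
      push Not at hcon
      linarith [P.mid y ⟨hyb, hcon⟩]
    have h1 := H.mono hs.2.le
    rw [P.coord_add_one H, hhy] at h1
    have h3 := hw (s + 1)
    push_cast at h3
    rw [abs_of_nonpos (by linarith)] at h3
    obtain ⟨j, hj, t, ht1, ht2⟩ := hvisit (h y)
    have h4 := H.lt_of_lt ht1
    have h5 : F^[j] x - t < a + 1 := H.lt_of_lt (by rw [P.coord_add_one H]; linarith)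
    refine ⟨j, hj, ?_⟩
    rw [← P.D_sub_int _ t]
    exact P.decr ⟨hya.le, hs.2.le⟩ ⟨by linarith, h5.le⟩ h4.le

end FlatProfile

theorem nonneg_of_forall_neg_le_mul {q : ℕ → ℕ} (hq : ∀ R : ℝ, ∃ n, R < q n) {B y : ℝ}
    (h : ∀ n, -B ≤ q n * y) : 0 ≤ y := by
  by_contra! hy
  obtain ⟨n, hn⟩ := hq (B / -y)
  rw [div_lt_iff₀ (by linarith)] at hn
  linarith [h n]

theorem div_le_birkhoff_mean_sub {f : ℝ → ℝ} {φ φ' : ℝ → ℝ} {q : ℕ → ℕ}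
    (hq : ∀ R : ℝ, ∃ n, R < q n) {B B' χ χ' η : ℝ} {Q : ℕ} (hQ : 0 < Q) (hη : 0 ≤ η)
    (hχ : ∀ n x, |birkhoffSum f φ (q n) x - q n * χ| ≤ B)
    (hχ' : ∀ n x, |birkhoffSum f φ' (q n) x - q n * χ'| ≤ B')
    (hle : ∀ x, φ' x ≤ φ x) (hvisit : ∀ x, ∃ j < Q, φ' (f^[j] x) + η ≤ φ (f^[j] x)) :
    η / Q ≤ χ - χ' := by
  have hQ' : (0 : ℝ) < Q := by exact_mod_cast hQ
  set d : ℝ → ℝ := fun x => φ x - φ' x with hd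
  have hd0 : ∀ x, 0 ≤ d x := fun x => sub_nonneg.2 (hle x)
  have hdQ : ∀ x, η ≤ birkhoffSum f d Q x := by
    intro x
    obtain ⟨j, hj, hjx⟩ := hvisit x
    refine le_trans (by simp only [hd]; linarith) (Finset.single_le_sum (f := fun j => d (f^[j] x))
      (fun j _ => hd0 _) (Finset.mem_range.2 hj))
  have hsum : ∀ n x, birkhoffSum f d n x = birkhoffSum f φ n x - birkhoffSum f φ' n x :=
    fun n x => Finset.sum_sub_distrib _ _
  rw [← sub_nonneg]
  refine nonneg_of_forall_neg_le_mul hq (B := B + B' + η) fun n => ?_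
  have h1 := mul_le_birkhoffSum_mul f d Q hdQ (q n / Q) 0
  have h2 : birkhoffSum f d (q n / Q * Q) 0 ≤ birkhoffSum f d (q n) 0 :=
    Finset.sum_le_sum_of_subset_of_nonneg
      (Finset.range_subset_range.2 (Nat.div_mul_le_self _ _)) fun j _ _ => hd0 _
  have h3 : (q n : ℝ) / Q - 1 ≤ (q n / Q : ℕ) := by
    have : (q n : ℝ) / Q < (q n / Q : ℕ) + 1 := by
      rw [div_lt_iff₀ hQ']
      exact_mod_cast Nat.lt_mul_of_div_lt (Nat.lt_succ_self _) hQ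
    linarith
  have h4 := mul_le_mul_of_nonneg_right h3 hη
  have h8 := h1.trans h2
  rw [hsum] at h8
  have h5 := (abs_le.1 (hχ n 0)).2
  have h6 := (abs_le.1 (hχ' n 0)).1
  have h7 : (q n : ℝ) * (χ - χ' - η / Q) = q n * χ - q n * χ' - q n / Q * η := by ring
  rw [h7]
  linarith

theorem exists_geometric_decay {q : ℕ → ℕ} {β χ : ℕ → ℝ} {κ c M : ℝ} (hq : ∀ n, 0 < q n)
    (hκ : 0 < κ) (hc : 0 < c) (hM : 0 < M) (hgrow : ∀ n, 1 ≤ n → (1 + κ) * q n ≤ q (n + 1))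
    (hβ : ∀ n, 0 ≤ β n) (hχ : ∀ n, 0 ≤ χ n) (hχβ : ∀ n, q n * χ n ≤ M * (1 + β n))
    (hstep : ∀ n, c * (β (n + 1) - β n) / q n ≤ χ n - χ (n + 1)) :
    ∃ K > 0, ∃ r ∈ Set.Ioo (0 : ℝ) 1, ∀ n, 1 ≤ n → 1 + β n ≤ q n * (K * r ^ n) := by
  have hq' : ∀ n, (0 : ℝ) < q n := fun n => by exact_mod_cast hq n
  set u : ℕ → ℝ := fun n => (1 + β n) / q n with hu
  have hu0 : ∀ n, 0 < u n := fun n => div_pos (by linarith [hβ n]) (hq' n)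
  have hχu : ∀ n, χ n ≤ M * u n := fun n => by
    rw [hu, ← mul_div_assoc, le_div_iff₀ (hq' n), mul_comm]; exact hχβ n
  set A := M + c * (1 + κ) with hA
  have hcκ : 0 < c * κ := mul_pos hc hκ
  have hA0 : 0 < A := by nlinarith
  set Φ : ℕ → ℝ := fun n => χ n + c * (1 + κ) * u n with hΦ
  have hΦA : ∀ n, Φ n ≤ A * u n := fun n => by simp only [hΦ, hA]; linarith [hχu n]
  set r := 1 - c * κ / A with hr
  have hr0 : 0 < r := by
    rw [hr, sub_pos, div_lt_one hA0, hA]; linarith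
  have hr1 : r < 1 := by
    have : 0 < c * κ / A := div_pos hcκ hA0
    linarith
  have hrec : ∀ n, 1 ≤ n → Φ (n + 1) ≤ r * Φ n := by
    intro n hn
    have h1 : c * ((1 + κ) * u (n + 1) - u n) ≤ χ n - χ (n + 1) := by
      refine le_trans ?_ (hstep n)
      rw [mul_div_assoc]
      refine mul_le_mul_of_nonneg_left ?_ hc.le
      have e1 : β n = u n * q n - 1 := by simp only [hu]; field_simp [(hq' n).ne']; ring
      have e2 : β (n + 1) = u (n + 1) * q (n + 1) - 1 := by
        simp only [hu]; field_simp [(hq' (n + 1)).ne']; ring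
      rw [le_div_iff₀ (hq' n), e1, e2]
      nlinarith [hgrow n hn, hu0 (n + 1)]
    have h2 : Φ (n + 1) ≤ Φ n - c * κ * u n := by simp only [hΦ]; linarith
    have h3 : Φ n / A ≤ u n := by rw [div_le_iff₀ hA0, mul_comm]; exact hΦA n
    have h4 : r * Φ n = Φ n - c * κ * (Φ n / A) := by rw [hr]; ring
    rw [h4]
    nlinarith
  have hgeo : ∀ n, Φ (n + 1) ≤ r ^ n * Φ 1 := by
    intro n
    induction n with
    | zero => simp
    | succ n ih =>
      calc Φ (n + 1 + 1) ≤ r * Φ (n + 1) := hrec _ (by omega)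
        _ ≤ r * (r ^ n * Φ 1) := mul_le_mul_of_nonneg_left ih hr0.le
        _ = r ^ (n + 1) * Φ 1 := by ring
  have hc1 : 0 < c * (1 + κ) := by positivity
  have hΦ1 : 0 < Φ 1 := by
    have := mul_pos hc1 (hu0 1)
    simp only [hΦ]; linarith [hχ 1]
  refine ⟨Φ 1 / (r * (c * (1 + κ))), by positivity, r, ⟨hr0, hr1⟩, fun n hn => ?_⟩
  obtain ⟨n, rfl⟩ := Nat.exists_eq_add_of_le' hn
  have h1 : c * (1 + κ) * u (n + 1) ≤ r ^ n * Φ 1 := by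
    refine le_trans ?_ (hgeo n)
    simp only [hΦ]; linarith [hχ (n + 1)]
  have h2 : Φ 1 / (r * (c * (1 + κ))) * r ^ (n + 1) = r ^ n * Φ 1 / (c * (1 + κ)) := by
    field_simp
    ring
  rw [h2, mul_comm, ← div_le_iff₀ (hq' _), le_div_iff₀ hc1, mul_comm]
  exact h1

namespace FlatProfile

variable {F : CircleDeg1Lift} {D h : ℝ → ℝ} {a b δ e₀ Λ c₀ p τ L κ : ℝ} {q : ℕ → ℕ} {pn : ℕ → ℤ}

theorem truncLog_mono {ε ε' : ℝ} (hε : 0 < ε) (hle : ε ≤ ε') (x : ℝ) :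
    truncLog D ε x ≤ truncLog D ε' x :=
  Real.log_le_log (lt_max_of_lt_right hε) (max_le_max le_rfl hle)

/-- The mean of `truncLog D ε` drops linearly in `log ε` when the threshold `ε` decreases. -/
theorem div_le_birkhoff_mean_sub_succ (P : FlatProfile F D a b δ e₀ Λ c₀ p)
    (H : IsRotationCoord F τ h) (A : BoundedApprox τ q pn L κ) {B B' χ χ' : ℝ} {N N' Q : ℕ}
    (hN : N ≤ N')
    (hχ : ∀ n x, |birkhoffSum F (truncLog D (minDeriv F D b e₀ N)) (q n) x - q n * χ| ≤ B)
    (hχ' : ∀ n x, |birkhoffSum F (truncLog D (minDeriv F D b e₀ N')) (q n) x - q n * χ'| ≤ B')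
    (hR : 3 * N' ≤ κ * Q) (hQ : 1 ≤ Q) :
    (Real.log (minDeriv F D b e₀ N) - Real.log (minDeriv F D b e₀ N')) / (L * Q) ≤ χ - χ' := by
  have hpos := P.minDeriv_pos H A
  have hunb : ∀ R : ℝ, ∃ n, R < q n := fun R => by
    obtain ⟨m, hm, -⟩ := A.exists_q (max R 1) (le_max_right _ _)
    exact ⟨m, (le_max_left _ _).trans_lt hm⟩
  obtain ⟨m, hm1, hm2⟩ := A.exists_q Q (by exact_mod_cast hQ)
  have hmono := minDeriv_antitone F D b e₀ hN
  set η := Real.log (minDeriv F D b e₀ N) - Real.log (minDeriv F D b e₀ N') with hη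
  have hη0 : 0 ≤ η := sub_nonneg.2 (Real.log_le_log (hpos _) hmono)
  have hqm : (0 : ℝ) < q m := by exact_mod_cast A.q_pos m
  refine le_trans (div_le_div_of_nonneg_left hη0 hqm hm2)
    (div_le_birkhoff_mean_sub hunb (A.q_pos m) hη0 hχ hχ' (truncLog_mono (hpos _) hmono)
      fun x => ?_)
  rcases (minDeriv_le F D b e₀ N').lt_or_eq with hlt | heq
  · obtain ⟨j, hj, hjD⟩ := P.exists_lt_D_iterate_le H A (m := m) hlt (by
      rw [div_lt_iff₀ A.κ_pos]
      nlinarith [A.κ_pos]) x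
    refine ⟨j, hj, ?_⟩
    rw [truncLog, truncLog, max_eq_right hjD, max_eq_right (hjD.trans hmono), hη]
    linarith
  · have h0 : η = 0 := by
      rw [hη, le_antisymm ((minDeriv_le F D b e₀ N).trans heq.ge) hmono, sub_self]
    refine ⟨0, A.q_pos m, ?_⟩
    rw [h0, add_zero]
    exact truncLog_mono (hpos _) hmono _

theorem exists_neg_log_le (P : FlatProfile F D a b δ e₀ Λ c₀ p)
    (H : IsRotationCoord F τ h) (A : BoundedApprox τ q pn L κ) (hq : Monotone q) :
    ∃ K > 0, ∃ r ∈ Set.Ioo (0 : ℝ) 1, ∀ n, 1 ≤ n → ∀ s : ℤ,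
      -Real.log |F (F^[q n] b) - F b - s| ≤ q n * (K * r ^ n) := by
  have hκ := A.κ_pos
  have hq' : ∀ n, (1 : ℝ) ≤ q n := fun n => by exact_mod_cast A.q_pos n
  have hL : 0 < L := by
    have := A.q_succ_le 0
    nlinarith [hq' 0, hq' 1]
  have hpos := P.minDeriv_pos H A
  set e : ℕ → ℝ := fun k => minDeriv F D b e₀ (2 * q k) with he
  set β : ℕ → ℝ := fun k => -Real.log (e k) with hβdef
  have hβ : ∀ k, 0 ≤ β k := fun k =>
    neg_nonneg.2 (Real.log_nonpos (hpos _).le ((minDeriv_le _ _ _ _ _).trans P.e₀_le_one))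
  obtain ⟨C, hC⟩ := P.exists_variation_bound
  have hmean : ∀ k, ∃ χ : ℝ, ∀ n x,
      |birkhoffSum F (truncLog D (e k)) (q n) x - q n * χ| ≤ 20 * (C + 2 * β k) := by
    intro k
    refine exists_birkhoff_mean A.q_pos fun n x z => ?_
    have := abs_birkhoffSum_sub_le H (A.q_pos n) (A.coprime n) (A.approx n)
      (hC (e k) (hpos _) (minDeriv_le _ _ _ _ _)) x z
    refine this.trans (le_of_eq ?_)
    simp only [hβdef]; ring
  choose χ hχ using hmean
  have hunb : ∀ R : ℝ, ∃ n, R < q n := fun R => by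
    obtain ⟨m, hm, -⟩ := A.exists_q (max R 1) (le_max_right _ _)
    exact ⟨m, (le_max_left _ _).trans_lt hm⟩
  have hχ0 : ∀ k, 0 ≤ χ k := fun k =>
    nonneg_of_forall_neg_le_mul hunb (B := 20 * (C + 2 * β k)) fun n => by
      obtain ⟨x, hx⟩ := P.exists_birkhoffSum_nonneg (e k) (q n)
      linarith [(abs_le.1 (hχ k n x)).2]
  set M := 20 * |C| + 40 + |Real.log c₀| + p with hM
  have hp := P.p_nonneg
  have hM0 : 0 < M := by positivity
  have hχβ : ∀ k, q k * χ k ≤ M * (1 + β k) := fun k => by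
    obtain ⟨x, hx⟩ := P.exists_birkhoffSum_le H A (A.q_pos k)
    have h1 := (abs_le.1 (hχ k k x)).1
    have h2 : birkhoffSum F (truncLog D (e k)) (q k) x ≤ -Real.log c₀ + p * β k := by
      simp only [hβdef, mul_neg]; linarith
    have h3 := neg_le_abs (Real.log c₀)
    have h4 := le_abs_self C
    have h5 := mul_nonneg (abs_nonneg C) (hβ k)
    have h6 := mul_nonneg (abs_nonneg (Real.log c₀)) (hβ k)
    rw [hM]
    linarith
  set S := 6 * L / κ + 1 with hS
  have hS0 : 0 < S := by positivity
  have hstep : ∀ k, 1 / (L * (S + 1)) * (β (k + 1) - β k) / q k ≤ χ k - χ (k + 1) := by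
    intro k
    have h1 := P.div_le_birkhoff_mean_sub_succ H A (Q := ⌈S * q k⌉₊)
      (Nat.mul_le_mul_left 2 (hq (Nat.le_succ k))) (hχ k) (hχ (k + 1)) ?_ ?_
    · refine le_trans ?_ h1
      have h2 : (⌈S * q k⌉₊ : ℝ) ≤ (S + 1) * q k := by
        have := Nat.ceil_lt_add_one (mul_nonneg hS0.le (zero_le_one.trans (hq' k)))
        linarith [hq' k]
      have h3 : (0 : ℝ) < ⌈S * q k⌉₊ :=
        lt_of_lt_of_le (mul_pos hS0 (by linarith [hq' k])) (Nat.le_ceil _)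
      have h4 : 0 ≤ Real.log (minDeriv F D b e₀ (2 * q k)) -
          Real.log (minDeriv F D b e₀ (2 * q (k + 1))) :=
        sub_nonneg.2 (Real.log_le_log (hpos _)
          (minDeriv_antitone F D b e₀ (Nat.mul_le_mul_left 2 (hq (Nat.le_succ k)))))
      have h5 : 1 / (L * (S + 1)) * (β (k + 1) - β k) / q k =
          (Real.log (minDeriv F D b e₀ (2 * q k)) -
          Real.log (minDeriv F D b e₀ (2 * q (k + 1)))) / (L * ((S + 1) * q k)) := by
        have := hq' k
        simp only [hβdef, he]
        field_simp
        ring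
      rw [h5]
      gcongr
    · have h2 : κ * (S * q k) ≤ κ * ⌈S * q k⌉₊ :=
        mul_le_mul_of_nonneg_left (Nat.le_ceil _) hκ.le
      have h3 : κ * (S * q k) = 6 * (L * q k) + κ * q k := by
        rw [hS]; field_simp
      have h4 := A.q_succ_le k
      push_cast
      nlinarith [hq' k]
    · exact Nat.ceil_pos.2 (mul_pos hS0 (by linarith [hq' k]))
  obtain ⟨K, hK, r, hr, hKr⟩ := exists_geometric_decay A.q_pos hκ (by positivity) hM0
    A.le_q_succ hβ hχ0 hχβ hstep
  have hG : 0 < |Real.log c₀| + p + 1 := by positivity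
  refine ⟨(|Real.log c₀| + p + 1) * K, by positivity, r, hr, fun n hn s => ?_⟩
  have h1 : 0 < D (F^[q n] b) := P.D_iterate_pos H A (A.q_pos n)
  have h2 : e n ≤ D (F^[q n] b) := minDeriv_le_apply _ _ _ _ (A.q_pos n) (by omega)
  have h3 : c₀ * e n ^ p ≤ |F (F^[q n] b) - F b - s| := by
    refine le_trans ?_ (P.far_int h1 s)
    have := P.c₀_pos
    have : 0 < e n := hpos _
    gcongr
  have hep : 0 < e n ^ p := Real.rpow_pos_of_pos (hpos _) _
  have h4 := Real.log_le_log (mul_pos P.c₀_pos hep) h3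
  rw [Real.log_mul P.c₀_pos.ne' hep.ne', Real.log_rpow (hpos _)] at h4
  have h5 : Real.log (e n) = -β n := by simp only [hβdef, neg_neg]
  rw [h5] at h4
  have h6 := mul_nonneg (abs_nonneg (Real.log c₀)) (hβ n)
  have h7 := neg_le_abs (Real.log c₀)
  calc -Real.log |F (F^[q n] b) - F b - s| ≤ (|Real.log c₀| + p + 1) * (1 + β n) := by
        nlinarith [hβ n]
    _ ≤ (|Real.log c₀| + p + 1) * (q n * (K * r ^ n)) :=
        mul_le_mul_of_nonneg_left (hKr n hn) hG.le
    _ = _ := by ring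

end FlatProfile

/-- The derivative of `t ↦ ψ (t ^ ℓ)`. -/
noncomputable def powerSlope (ψ : ℝ → ℝ) (ℓ t : ℝ) : ℝ := deriv ψ (t ^ ℓ) * (ℓ * t ^ (ℓ - 1))

theorem powerSlope_zero (ψ : ℝ → ℝ) {ℓ : ℝ} (hℓ : 1 < ℓ) : powerSlope ψ ℓ 0 = 0 := by
  rw [powerSlope, Real.zero_rpow (by linarith : ℓ - 1 ≠ 0), mul_zero, mul_zero]

theorem hasDerivAt_comp_rpow {ψ : ℝ → ℝ} {ℓ : ℝ} (hℓ : 1 < ℓ) (hψ : Differentiable ℝ ψ) (t : ℝ) :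
    HasDerivAt (fun t => ψ (t ^ ℓ)) (powerSlope ψ ℓ t) t :=
  (hψ _).hasDerivAt.comp t (Real.hasDerivAt_rpow_const (Or.inr hℓ.le))

theorem exists_powerSlope_bound {ψ : ℝ → ℝ} {ℓ : ℝ} (hℓ : 1 < ℓ)
    (hψ : ContDiff ℝ (⊤ : ℕ∞) ψ) (h0 : ψ 0 = 0) (hpos : 0 < deriv ψ 0) {ε : ℝ} (hε : 0 < ε) :
    ∃ δ, 0 < δ ∧ δ < ε ∧ ∃ c > 0, MonotoneOn (powerSlope ψ ℓ) (Set.Icc 0 δ) ∧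
      ∀ t ∈ Set.Icc 0 δ, c * powerSlope ψ ℓ t ^ (ℓ / (ℓ - 1)) ≤ ψ (t ^ ℓ) := by
  set A := deriv ψ 0 with hA
  have hψ1 : ContDiff ℝ (⊤ : ℕ∞) (deriv ψ) := (contDiff_infty_iff_deriv.1 hψ).2
  have hψ2 : ContDiff ℝ (⊤ : ℕ∞) (deriv (deriv ψ)) := (contDiff_infty_iff_deriv.1 hψ1).2
  have hd : Differentiable ℝ ψ := (contDiff_infty_iff_deriv.1 hψ).1
  have hd1 : Differentiable ℝ (deriv ψ) := (contDiff_infty_iff_deriv.1 hψ1).1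
  have c1 : Continuous (deriv ψ) := hψ1.continuous
  have c2 : Continuous fun s => ℓ * s * deriv (deriv ψ) s + (ℓ - 1) * deriv ψ s := by
    have := hψ2.continuous
    fun_prop
  have ev : ∀ᶠ s in nhds (0 : ℝ), A / 2 < deriv ψ s ∧ deriv ψ s < 2 * A ∧
      0 < ℓ * s * deriv (deriv ψ) s + (ℓ - 1) * deriv ψ s := by
    refine (c1.continuousAt.eventually (lt_mem_nhds (by linarith))).and
      ((c1.continuousAt.eventually (gt_mem_nhds (by linarith))).and
        (c2.continuousAt.eventually (lt_mem_nhds ?_)))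
    have : 0 < (ℓ - 1) * A := mul_pos (by linarith) hpos
    simpa using this
  obtain ⟨r, hr, hball⟩ := Metric.eventually_nhds_iff.1 ev
  have hs : ∀ s, 0 ≤ s → s < r → A / 2 < deriv ψ s ∧ deriv ψ s < 2 * A ∧
      0 < ℓ * s * deriv (deriv ψ) s + (ℓ - 1) * deriv ψ s := fun s h1 h2 =>
    hball (by rwa [Real.dist_eq, sub_zero, abs_of_nonneg h1])
  set δ := min (min ε r) 1 / 2 with hδ
  have hm : 0 < min (min ε r) 1 := lt_min (lt_min hε hr) one_pos
  have hm1 : min (min ε r) 1 ≤ min ε r := min_le_left _ _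
  have hm2 : min (min ε r) 1 ≤ 1 := min_le_right _ _
  have hδ0 : 0 < δ := by linarith
  have hδε : δ < ε := by linarith [min_le_left ε r]
  have hδr : δ < r := by linarith [min_le_right ε r]
  have hpow : ∀ t ∈ Set.Icc 0 δ, 0 ≤ t ^ ℓ ∧ t ^ ℓ < r := fun t ht =>
    ⟨Real.rpow_nonneg ht.1 _, lt_of_le_of_lt (by
      have := Real.rpow_le_rpow_of_exponent_ge' ht.1 (by linarith [ht.2]) zero_le_one hℓ.le
      rw [Real.rpow_one] at this
      exact this.trans ht.2) hδr⟩
  refine ⟨δ, hδ0, hδε, A / 2 / (2 * A * ℓ) ^ (ℓ / (ℓ - 1)), by positivity, ?_, fun t ht => ?_⟩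
  · have hcont : Continuous (powerSlope ψ ℓ) :=
      (c1.comp (Real.continuous_rpow_const (by linarith))).mul
        (continuous_const.mul (Real.continuous_rpow_const (by linarith)))
    have hderiv : ∀ t ∈ interior (Set.Icc 0 δ), HasDerivAt (powerSlope ψ ℓ)
        (deriv (deriv ψ) (t ^ ℓ) * (ℓ * t ^ (ℓ - 1)) * (ℓ * t ^ (ℓ - 1)) +
          deriv ψ (t ^ ℓ) * (ℓ * ((ℓ - 1) * t ^ (ℓ - 1 - 1)))) t := by
      intro t ht
      rw [interior_Icc] at ht
      exact ((hd1 _).hasDerivAt.comp t (Real.hasDerivAt_rpow_const (Or.inr hℓ.le))).mul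
        ((Real.hasDerivAt_rpow_const (Or.inl ht.1.ne')).const_mul ℓ)
    refine monotoneOn_of_deriv_nonneg (convex_Icc _ _) hcont.continuousOn
      (fun t ht => (hderiv t ht).differentiableAt.differentiableWithinAt) fun t ht => ?_
    rw [(hderiv t ht).deriv]
    rw [interior_Icc] at ht
    have h1 := hs (t ^ ℓ) (hpow t ⟨ht.1.le, ht.2.le⟩).1 (hpow t ⟨ht.1.le, ht.2.le⟩).2
    have h2 : t ^ (ℓ - 1) * t ^ (ℓ - 1) = t ^ (ℓ - 1 - 1) * t ^ ℓ := by
      rw [← Real.rpow_add ht.1, ← Real.rpow_add ht.1]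
      congr 1; ring
    have h3 : 0 < t ^ (ℓ - 1 - 1) := Real.rpow_pos_of_pos ht.1 _
    calc 0 ≤ ℓ * t ^ (ℓ - 1 - 1) *
          (ℓ * t ^ ℓ * deriv (deriv ψ) (t ^ ℓ) + (ℓ - 1) * deriv ψ (t ^ ℓ)) :=
          mul_nonneg (by positivity) h1.2.2.le
      _ = deriv (deriv ψ) (t ^ ℓ) * ℓ * ℓ * (t ^ (ℓ - 1 - 1) * t ^ ℓ) +
          deriv ψ (t ^ ℓ) * (ℓ * ((ℓ - 1) * t ^ (ℓ - 1 - 1))) := by ring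
      _ = _ := by rw [← h2]; ring
  · have hp := hpow t ht
    have h1 : A / 2 * t ^ ℓ ≤ ψ (t ^ ℓ) := by
      have := (convex_Icc 0 (t ^ ℓ)).mul_sub_le_image_sub_of_le_deriv hd.continuous.continuousOn
        hd.differentiableOn (C := A / 2) (fun s hs' => by
          rw [interior_Icc] at hs'
          exact (hs s hs'.1.le (hs'.2.trans hp.2)).1.le) 0 ⟨le_rfl, hp.1⟩ _ ⟨hp.1, le_rfl⟩ hp.1
      simpa [h0] using this
    have h2 := hs _ hp.1 hp.2
    have h3 : 0 ≤ t ^ (ℓ - 1) := Real.rpow_nonneg ht.1 _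
    have h4 : 0 ≤ powerSlope ψ ℓ t := mul_nonneg (by linarith) (by positivity)
    have h5 : powerSlope ψ ℓ t ≤ 2 * A * ℓ * t ^ (ℓ - 1) := by
      rw [powerSlope, mul_assoc (2 * A)]
      exact mul_le_mul_of_nonneg_right h2.2.1.le (by positivity)
    have hℓ1 : 0 < ℓ - 1 := by linarith
    have h6 : powerSlope ψ ℓ t ^ (ℓ / (ℓ - 1)) ≤ (2 * A * ℓ) ^ (ℓ / (ℓ - 1)) * t ^ ℓ := by
      have := Real.rpow_le_rpow h4 h5 (z := ℓ / (ℓ - 1)) (by positivity)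
      rwa [Real.mul_rpow (by positivity) h3, ← Real.rpow_mul ht.1,
        mul_div_cancel₀ ℓ hℓ1.ne'] at this
    refine le_trans ?_ h1
    rw [div_mul_eq_mul_div, div_le_iff₀ (by positivity), mul_assoc, mul_comm (t ^ ℓ)]
    exact mul_le_mul_of_nonneg_left h6 (by positivity)

theorem exists_lipschitz_log {g : ℝ → ℝ} {s K : Set ℝ} (hs : IsOpen s) (hg : ContDiffOn ℝ 1 g s)
    (hpos : ∀ x ∈ s, 0 < g x) (hK : IsCompact K) (hKs : K ⊆ s) :
    ∃ Λ : ℝ, ∀ x ∈ K, ∀ y ∈ K, |Real.log (g x) - Real.log (g y)| ≤ Λ * |x - y| := by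
  have h : LocallyLipschitzOn K fun x => Real.log (g x) := fun x hx => by
    obtain ⟨C, t, ht, hC⟩ := ((hg.contDiffAt (hs.mem_nhds (hKs hx))).log
      (hpos x (hKs hx)).ne').exists_lipschitzOnWith
    exact ⟨C, t, mem_nhdsWithin_of_mem_nhds ht, hC⟩
  obtain ⟨C, hC⟩ := h.exists_lipschitzOnWith_of_compact hK
  exact ⟨C, fun x hx y hy => by simpa [Real.dist_eq] using hC.dist_le_mul x hx y hy⟩

namespace CherryMap

variable {ℓ : ℝ}

/-- The lift of a Cherry map as a bundled degree one lift. -/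
def lift (X : CherryMap ℓ) : CircleDeg1Lift where
  toFun := X.F
  monotone' := X.mono
  map_add_one' := X.degree_one

theorem coe_lift (X : CherryMap ℓ) : ⇑X.lift = X.F := rfl

theorem F_sub_int (X : CherryMap ℓ) (x : ℝ) (m : ℤ) : X.F (x - m) = X.F x - m :=
  X.lift.map_sub_int x m

theorem F_b (X : CherryMap ℓ) : X.F X.b = X.F X.a := X.flat _ ⟨X.hab.le, le_rfl⟩

theorem F_b_add (X : CherryMap ℓ) {x : ℝ} (hx : x ∈ Set.Ico X.b (X.b + X.ε)) :
    X.F x = X.F X.b + X.ψb ((x - X.b) ^ ℓ) := by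
  simpa using X.local_b (x - X.b) ⟨by linarith [hx.1], by linarith [hx.2]⟩

theorem F_a_sub (X : CherryMap ℓ) {x : ℝ} (hx : x ∈ Set.Ioc (X.a - X.ε) X.a) :
    X.F x = X.F X.a - X.ψa ((X.a - x) ^ ℓ) := by
  simpa using X.local_a (X.a - x) ⟨by linarith [hx.2], by linarith [hx.1]⟩

theorem hasDerivAt_F_b_add (X : CherryMap ℓ) (hℓ : 1 < ℓ) (x : ℝ) :
    HasDerivAt (fun x => X.F X.b + X.ψb ((x - X.b) ^ ℓ)) (powerSlope X.ψb ℓ (x - X.b)) x := by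
  have h := (hasDerivAt_comp_rpow hℓ (X.ψb_smooth.differentiable (by simp)) (x - X.b)).comp x
    ((hasDerivAt_id x).sub_const X.b)
  simpa using h.const_add (X.F X.b)

theorem hasDerivAt_F_a_sub (X : CherryMap ℓ) (hℓ : 1 < ℓ) (x : ℝ) :
    HasDerivAt (fun x => X.F X.a - X.ψa ((X.a - x) ^ ℓ)) (powerSlope X.ψa ℓ (X.a - x)) x := by
  have h := (hasDerivAt_comp_rpow hℓ (X.ψa_smooth.differentiable (by simp)) (X.a - x)).comp x
    ((hasDerivAt_id x).const_sub X.a)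
  simpa using h.const_sub (X.F X.a)

theorem hasDerivAt_F_right (X : CherryMap ℓ) (hℓ : 1 < ℓ) {x : ℝ}
    (hx : x ∈ Set.Ico X.b (X.b + X.ε)) : HasDerivAt X.F (powerSlope X.ψb ℓ (x - X.b)) x := by
  rcases hx.1.eq_or_lt with rfl | hlt
  · have hr : HasDerivWithinAt X.F 0 (Set.Ici X.b) X.b := by
      have h := (X.hasDerivAt_F_b_add hℓ X.b).hasDerivWithinAt (s := Set.Ici X.b)
      rw [sub_self, powerSlope_zero _ hℓ] at h
      refine h.congr_of_eventuallyEq ?_ (X.F_b_add hx)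
      filter_upwards [Ico_mem_nhdsGE hx.2] with y hy using X.F_b_add hy
    have hl : HasDerivWithinAt X.F 0 (Set.Iic X.b) X.b := by
      refine (hasDerivWithinAt_const X.b _ (X.F X.a)).congr_of_eventuallyEq ?_ X.F_b
      filter_upwards [Ioc_mem_nhdsLE X.hab] with y hy using X.flat _ ⟨hy.1.le, hy.2⟩
    rw [sub_self, powerSlope_zero _ hℓ]
    simpa using hl.union hr
  · refine (X.hasDerivAt_F_b_add hℓ x).congr_of_eventuallyEq ?_
    filter_upwards [Ioo_mem_nhds hlt hx.2] with y hy using X.F_b_add ⟨hy.1.le, hy.2⟩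

theorem hasDerivAt_F_left (X : CherryMap ℓ) (hℓ : 1 < ℓ) {x : ℝ}
    (hx : x ∈ Set.Ioc (X.a - X.ε) X.a) : HasDerivAt X.F (powerSlope X.ψa ℓ (X.a - x)) x := by
  rcases hx.2.eq_or_lt with rfl | hlt
  · have hl : HasDerivWithinAt X.F 0 (Set.Iic X.a) X.a := by
      have h := (X.hasDerivAt_F_a_sub hℓ X.a).hasDerivWithinAt (s := Set.Iic X.a)
      rw [sub_self, powerSlope_zero _ hℓ] at h
      refine h.congr_of_eventuallyEq ?_ (X.F_a_sub hx)
      filter_upwards [Ioc_mem_nhdsLE hx.1] with y hy using X.F_a_sub hy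
    have hr : HasDerivWithinAt X.F 0 (Set.Ici X.a) X.a := by
      refine (hasDerivWithinAt_const X.a _ (X.F X.a)).congr_of_eventuallyEq ?_ rfl
      filter_upwards [Ico_mem_nhdsGE X.hab] with y hy using X.flat _ ⟨hy.1, hy.2.le⟩
    rw [sub_self, powerSlope_zero _ hℓ]
    simpa using hl.union hr
  · refine (X.hasDerivAt_F_a_sub hℓ x).congr_of_eventuallyEq ?_
    filter_upwards [Ioo_mem_nhds hx.1 hlt] with y hy using X.F_a_sub ⟨hy.1, hy.2.le⟩

theorem hasDerivAt_F_flat (X : CherryMap ℓ) (hℓ : 1 < ℓ) {x : ℝ} (hx : x ∈ Set.Icc X.a X.b) :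
    HasDerivAt X.F 0 x := by
  have hε := X.εpos
  rcases hx.1.eq_or_lt with rfl | ha
  · simpa [powerSlope_zero _ hℓ] using
      X.hasDerivAt_F_left hℓ (x := X.a) ⟨by linarith, le_rfl⟩
  rcases hx.2.eq_or_lt with rfl | hb
  · simpa [powerSlope_zero _ hℓ] using
      X.hasDerivAt_F_right hℓ (x := X.b) ⟨le_rfl, by linarith⟩
  refine (hasDerivAt_const x (X.F X.a)).congr_of_eventuallyEq ?_
  filter_upwards [Ioo_mem_nhds ha hb] with y hy using X.flat _ ⟨hy.1.le, hy.2.le⟩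

theorem hasDerivAt_F_of_sub_int (X : CherryMap ℓ) {x d : ℝ} (m : ℤ)
    (h : HasDerivAt X.F d (x - m)) : HasDerivAt X.F d x := by
  refine ((h.comp_sub_const x m).add_const (m : ℝ)).congr_of_eventuallyEq
    (Eventually.of_forall fun y => ?_)
  simp [X.F_sub_int]

theorem differentiable_F (X : CherryMap ℓ) (hℓ : 1 < ℓ) : Differentiable ℝ X.F := by
  intro x
  suffices h : DifferentiableAt ℝ X.F (x - ⌊x - X.a⌋) from
    (X.hasDerivAt_F_of_sub_int _ h.hasDerivAt).differentiableAt
  have h1 := Int.floor_le (x - X.a)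
  have h2 := Int.lt_floor_add_one (x - X.a)
  rcases le_or_gt (x - ⌊x - X.a⌋) X.b with h | h
  · exact (X.hasDerivAt_F_flat hℓ ⟨by linarith, h⟩).differentiableAt
  · exact (X.smooth.differentiableOn (by simp)).differentiableAt
      (Ioo_mem_nhds h (by linarith))

theorem deriv_F_left_add_one (X : CherryMap ℓ) (hℓ : 1 < ℓ) {x : ℝ}
    (hx : x ∈ Set.Ioc (X.a + 1 - X.ε) (X.a + 1)) :
    deriv X.F x = powerSlope X.ψa ℓ (X.a + 1 - x) := by
  have h := X.hasDerivAt_F_left hℓ (x := x - (1 : ℤ))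
    ⟨by push_cast; linarith [hx.1], by push_cast; linarith [hx.2]⟩
  rw [(X.hasDerivAt_F_of_sub_int 1 h).deriv]
  congr 1
  push_cast; ring

theorem F_left_add_one (X : CherryMap ℓ) {x : ℝ} (hx : x ∈ Set.Ioc (X.a + 1 - X.ε) (X.a + 1)) :
    X.F x = X.F X.b + 1 - X.ψa ((X.a + 1 - x) ^ ℓ) := by
  have h := X.F_a_sub (x := x - 1) ⟨by linarith [hx.1], by linarith [hx.2]⟩
  have h1 := X.degree_one (x - 1)
  rw [sub_add_cancel] at h1
  rw [h1, h, X.F_b]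
  ring_nf

theorem exists_flatProfile (X : CherryMap ℓ) (hℓ : 1 < ℓ) :
    ∃ δ e₀ Λ c₀, FlatProfile X.lift (deriv X.F) X.a X.b δ e₀ Λ c₀ (ℓ / (ℓ - 1)) := by
  obtain ⟨δa, hδa, hδaε, ca, hca, hma, hba⟩ :=
    exists_powerSlope_bound hℓ X.ψa_smooth X.ψa_zero X.ψa_deriv_pos X.εpos
  obtain ⟨δb, hδb, hδbε, cb, hcb, hmb, hbb⟩ :=
    exists_powerSlope_bound hℓ X.ψb_smooth X.ψb_zero X.ψb_deriv_pos X.εpos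
  have hba' := X.hba
  obtain ⟨δ, hδ, hδ1, hδ2, hδ3⟩ : ∃ δ, 0 < δ ∧ δ ≤ δa ∧ δ ≤ δb ∧ δ ≤ (X.a + 1 - X.b) / 2 :=
    ⟨min (min δa δb) ((X.a + 1 - X.b) / 2), lt_min (lt_min hδa hδb) (by linarith),
      (min_le_left _ _).trans (min_le_left _ _), (min_le_left _ _).trans (min_le_right _ _),
      min_le_right _ _⟩
  have hp0 : 0 ≤ ℓ / (ℓ - 1) := div_nonneg (by linarith) (by linarith)
  have hDb : ∀ x ∈ Set.Icc X.b (X.b + δ), deriv X.F x = powerSlope X.ψb ℓ (x - X.b) :=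
    fun x hx => (X.hasDerivAt_F_right hℓ ⟨hx.1, by linarith [hx.2]⟩).deriv
  have hDa : ∀ x ∈ Set.Icc (X.a + 1 - δ) (X.a + 1),
      deriv X.F x = powerSlope X.ψa ℓ (X.a + 1 - x) :=
    fun x hx => X.deriv_F_left_add_one hℓ ⟨by linarith [hx.1], hx.2⟩
  have hincr : MonotoneOn (deriv X.F) (Set.Icc X.b (X.b + δ)) := fun x hx y hy hxy => by
    rw [hDb x hx, hDb y hy]
    exact hmb ⟨by linarith [hx.1], by linarith [hx.2]⟩ ⟨by linarith [hy.1], by linarith [hy.2]⟩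
      (by linarith)
  have hdecr : AntitoneOn (deriv X.F) (Set.Icc (X.a + 1 - δ) (X.a + 1)) := fun x hx y hy hxy => by
    rw [hDa x hx, hDa y hy]
    exact hma ⟨by linarith [hy.2], by linarith [hy.1]⟩ ⟨by linarith [hx.2], by linarith [hx.1]⟩
      (by linarith)
  have hsub : Set.Icc (X.b + δ) (X.a + 1 - δ) ⊆ Set.Ioo X.b (X.a + 1) :=
    fun x hx => ⟨by linarith [hx.1], by linarith [hx.2]⟩
  have hne : (Set.Icc (X.b + δ) (X.a + 1 - δ)).Nonempty := Set.nonempty_Icc.2 (by linarith)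
  have hD1 : ContDiffOn ℝ 1 (deriv X.F) (Set.Ioo X.b (X.a + 1)) :=
    X.smooth.deriv_of_isOpen isOpen_Ioo (by norm_cast)
  have hDc := hD1.continuousOn.mono hsub
  obtain ⟨Λ, hΛ⟩ := exists_lipschitz_log isOpen_Ioo hD1 X.deriv_pos isCompact_Icc hsub
  obtain ⟨x₀, hx₀, hmin⟩ := isCompact_Icc.exists_isMinOn hne hDc
  obtain ⟨x₁, hx₁, hmax⟩ := isCompact_Icc.exists_isMaxOn hne hDc
  rw [isMinOn_iff] at hmin
  rw [isMaxOn_iff] at hmax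
  set m := deriv X.F x₀ with hm
  set M := deriv X.F x₁ with hM
  have hm0 : 0 < m := X.deriv_pos _ (hsub hx₀)
  have hmM : m ≤ M := hmin _ hx₁
  have hDM : ∀ x ∈ Set.Ioo X.b (X.a + 1), deriv X.F x ≤ M := by
    intro x hx
    rcases le_total x (X.b + δ) with h1 | h1
    · exact (hincr ⟨hx.1.le, h1⟩ ⟨by linarith, le_rfl⟩ h1).trans
        (hmax _ ⟨le_rfl, by linarith⟩)
    rcases le_total x (X.a + 1 - δ) with h2 | h2
    · exact hmax _ ⟨h1, h2⟩
    · exact (hdecr ⟨le_rfl, by linarith⟩ ⟨h2, hx.2.le⟩ h2).trans (hmax _ ⟨by linarith, le_rfl⟩)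
  set P := ℓ / (ℓ - 1) with hP
  set c₁ := min ca cb with hc₁
  have hc₁0 : 0 < c₁ := lt_min hca hcb
  have hM0 : 0 < M := hm0.trans_le hmM
  have hnearb : ∀ x ∈ Set.Icc X.b (X.b + δ), c₁ * deriv X.F x ^ P ≤ X.F x - X.F X.b := by
    intro x hx
    rw [X.F_b_add ⟨hx.1, by linarith [hx.2]⟩, add_sub_cancel_left]
    refine le_trans ?_ (hbb (x - X.b) ⟨by linarith [hx.1], by linarith [hx.2]⟩)
    rw [hDb x hx]
    refine mul_le_mul_of_nonneg_right (min_le_right _ _) (Real.rpow_nonneg ?_ _)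
    rw [← hDb x hx]
    exact X.mono.deriv_nonneg
  have hneara : ∀ x ∈ Set.Icc (X.a + 1 - δ) (X.a + 1),
      c₁ * deriv X.F x ^ P ≤ X.F X.b + 1 - X.F x := by
    intro x hx
    rw [X.F_left_add_one ⟨by linarith [hx.1], hx.2⟩, sub_sub_cancel]
    refine le_trans ?_ (hba (X.a + 1 - x) ⟨by linarith [hx.2], by linarith [hx.1]⟩)
    rw [hDa x hx]
    refine mul_le_mul_of_nonneg_right (min_le_left _ _) (Real.rpow_nonneg ?_ _)
    rw [← hDa x hx]
    exact X.mono.deriv_nonneg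
  have hc₀1 : ∀ x, c₁ * (m / M) ^ P * deriv X.F x ^ P ≤ c₁ * deriv X.F x ^ P := fun x => by
    have h1 : (m / M) ^ P ≤ 1 :=
      Real.rpow_le_one (by positivity) ((div_le_one hM0).2 hmM) hp0
    have h2 : 0 ≤ deriv X.F x ^ P := Real.rpow_nonneg X.mono.deriv_nonneg _
    calc c₁ * (m / M) ^ P * deriv X.F x ^ P ≤ c₁ * 1 * deriv X.F x ^ P := by gcongr
      _ = _ := by rw [mul_one]
  have hc₀2 : ∀ x ∈ Set.Ioo X.b (X.a + 1), ∀ y ∈ Set.Icc (X.b + δ) (X.a + 1 - δ),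
      c₁ * (m / M) ^ P * deriv X.F x ^ P ≤ c₁ * deriv X.F y ^ P := fun x hx y hy => by
    have h0 : 0 ≤ deriv X.F x := X.mono.deriv_nonneg
    rw [mul_assoc, ← Real.mul_rpow (by positivity) h0]
    refine mul_le_mul_of_nonneg_left (Real.rpow_le_rpow (by positivity) ?_ hp0) hc₁0.le
    refine le_trans ?_ (hmin y hy)
    rw [div_mul_eq_mul_div, div_le_iff₀ hM0]
    exact mul_le_mul_of_nonneg_left (hDM x hx) hm0.le
  refine ⟨δ, min m 1, Λ, c₁ * (m / M) ^ P, fun x => (X.differentiable_F hℓ x).hasDerivAt, X.hab,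
    hδ, by linarith, lt_min hm0 one_pos, min_le_right _ _, X.F_b.symm,
    fun x hx => (X.hasDerivAt_F_flat hℓ hx).deriv, X.deriv_pos, hincr, hdecr,
    fun x hx => (min_le_left _ _).trans (hmin x hx), hΛ,
    mul_pos hc₁0 (Real.rpow_pos_of_pos (by positivity) _), hp0, fun x hx => ⟨?_, ?_⟩⟩
  · rcases le_total x (X.b + δ) with h1 | h1
    · exact (hc₀1 x).trans (hnearb x ⟨hx.1.le, h1⟩)
    · have h2 := hnearb (X.b + δ) ⟨by linarith, le_rfl⟩
      have h3 := hc₀2 x hx (X.b + δ) ⟨le_rfl, by linarith⟩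
      have h4 := X.mono h1
      rw [coe_lift]
      linarith
  · rcases le_total x (X.a + 1 - δ) with h1 | h1
    · have h2 := hneara (X.a + 1 - δ) ⟨le_rfl, by linarith⟩
      have h3 := hc₀2 x hx (X.a + 1 - δ) ⟨by linarith, le_rfl⟩
      have h4 := X.mono h1
      rw [coe_lift]
      linarith
    · exact (hc₀1 x).trans (hneara x ⟨h1, hx.2.le⟩)

theorem iterate_f_coe (X : CherryMap ℓ) (n : ℕ) (x : ℝ) :
    X.f^[n] (x : AddCircle (1 : ℝ)) = ((X.F^[n] x : ℝ) : AddCircle (1 : ℝ)) := by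
  induction n with
  | zero => rfl
  | succ n ih => rw [Function.iterate_succ_apply', ih, X.isLift, Function.iterate_succ_apply']

theorem exists_norm_iterate_c_sub (X : CherryMap ℓ) (n : ℕ) :
    ∃ s : ℤ, ‖X.f^[n] X.c - X.c‖ = |X.F (X.F^[n] X.b) - X.F X.b - s| := by
  have hc : X.c = ((X.F X.b : ℝ) : AddCircle (1 : ℝ)) := by rw [c, X.isLift, X.F_b]
  refine ⟨round (X.F (X.F^[n] X.b) - X.F X.b), ?_⟩
  rw [hc, iterate_f_coe, ← Function.iterate_succ_apply, Function.iterate_succ_apply',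
    ← AddCircle.coe_sub, UnitAddCircle.norm_eq]

theorem exists_translationNumber_eq (X : CherryMap ℓ) :
    ∃ m : ℤ, X.lift.translationNumber = X.rho + m := by
  obtain ⟨m, hm⟩ := X.rho_lim
  exact ⟨m, X.lift.translationNumber_eq_of_tendsto₀ (hm 0)⟩

end CherryMap

/-- for a Cherry map of exponent `ℓ ∈ (1,2]` with rotation number of bounded
type, there are `K > 0` and `C ∈ (0,1)` such that for all large `n`,
`(−log |f^{q_n}(c) − c|)/q_{n+1} ≤ K·Cⁿ`, where `|x − y|` is the shortest-arc distance. -/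
theorem neg_log_close_return_bound (ℓ : ℝ) (hℓ : ℓ ∈ Set.Ioc (1 : ℝ) 2)
    (X : CherryMap ℓ) (hbt : BoundedType X.rho) :
    ∃ K > 0, ∃ C ∈ Set.Ioo (0 : ℝ) 1, ∀ᶠ n in atTop,
      (-Real.log ‖X.f^[cfQ X.rho n] X.c - X.c‖) / (cfQ X.rho (n + 1) : ℝ) ≤ K * C ^ n := by
  obtain ⟨δ, e₀, Λ, c₀, P⟩ := X.exists_flatProfile hℓ.1
  obtain ⟨m, hm⟩ := X.exists_translationNumber_eq
  obtain ⟨h, h1, h2, h3⟩ := X.lift.exists_semiconj_translationNumber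
  rw [hm] at h3
  obtain ⟨L, κ, A⟩ := boundedApprox_cfQ X.rho_mem X.rho_irrational hbt m
  have hq := cfQ_le_succ X.rho_mem X.rho_irrational
  obtain ⟨K, hK, C, hC, hKC⟩ := P.exists_neg_log_le ⟨h1, h2, h3⟩ A (monotone_nat_of_le_succ hq)
  refine ⟨K, hK, C, hC, ?_⟩
  filter_upwards [eventually_ge_atTop 1] with n hn
  obtain ⟨s, hs⟩ := X.exists_norm_iterate_c_sub (cfQ X.rho n)
  have hKC0 : 0 ≤ K * C ^ n := mul_nonneg hK.le (pow_nonneg hC.1.le n)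
  have hpos : (0 : ℝ) < cfQ X.rho (n + 1) := by
    exact_mod_cast cfQ_pos X.rho_mem X.rho_irrational (n + 1)
  have hle : (cfQ X.rho n : ℝ) ≤ cfQ X.rho (n + 1) := by exact_mod_cast hq n
  rw [hs, div_le_iff₀ hpos, mul_comm (K * C ^ n)]
  exact (hKC n hn s).trans (mul_le_mul_of_nonneg_right hle hKC0)
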